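/- arXiv:math/0405274 — 2 statements merged into one kernel-verified Lean document; each statement's English description precedes it below -/
import Mathlib

section
/- Let G be the fundamental group of a terminal graph of groups, realized as a tree of spaces with vertex spaces and finite edge spaces, and let H be a one-ended finitely generated group. For any constants (A,B) there is an R, depending only on (A,B), G and H, such that for every (A,B)-quasi-isometric embedding f : H → G there is a (necessarily unique) vertex space X of G with f(H) contained in the R-neighborhood of X. -/
/-- Word distance on a group w.r.t. a generating set `S`. -/
noncomputable def wordDist {G : Type*} [Group G] (S : Set G) (g h : G) : ℕ :=
  sInf {n | ∃ l : List G, l.length = n ∧ (∀ x ∈ l, x ∈ S ∨ x⁻¹ ∈ S) ∧ l.prod = g⁻¹ * h}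

/-- `f` is a `(K, C)`-quasi-isometric embedding between the "metric spaces"
given by the distance functions `dX` and `dY`. -/
def IsQIEmbedding (K C : ℝ) {X Y : Type*} (dX : X → X → ℝ) (dY : Y → Y → ℝ)
    (f : X → Y) : Prop :=
  ∀ a b : X, (1 / K) * dX a b - C ≤ dY (f a) (f b) ∧ dY (f a) (f b) ≤ K * dX a b + C

/-- `f` is a `(K, C)`-quasi-isometry between the "metric spaces" given by the
distance functions `dX` and `dY`: a quasi-isometric embedding with `C`-coarsely
dense image. -/
def IsQuasiIsometry (K C : ℝ) {X Y : Type*} (dX : X → X → ℝ) (dY : Y → Y → ℝ)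
    (f : X → Y) : Prop :=
  IsQIEmbedding K C dX dY f ∧ ∀ y : Y, ∃ a : X, dY (f a) y ≤ C

/-- Two groups are quasi-isometric if they have finite generating sets for which
the word metrics admit a quasi-isometry between them (this is independent of the
choice of finite generating sets). -/
def QuasiIsometricGroups (G H : Type*) [Group G] [Group H] : Prop :=
  ∃ (S : Finset G) (T : Finset H), Subgroup.closure (S : Set G) = ⊤ ∧
    Subgroup.closure (T : Set H) = ⊤ ∧
    ∃ (K C : ℝ) (f : G → H), 0 < K ∧ 0 ≤ C ∧
      IsQuasiIsometry K C (fun a b => (wordDist (S : Set G) a b : ℝ))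
        (fun a b => (wordDist (T : Set H) a b : ℝ)) f

/-- The Cayley graph of a group with respect to a set `S` of generators. -/
def cayleyGraph {G : Type*} [Group G] (S : Set G) : SimpleGraph G :=
  SimpleGraph.fromRel (fun g h => g⁻¹ * h ∈ S)

/-- A finitely generated group has infinitely many ends: any of its Cayley
graphs w.r.t. a finite generating set has infinitely many ends. -/
def HasInfinitelyManyEnds (G : Type*) [Group G] : Prop :=
  ∀ S : Finset G, Subgroup.closure (S : Set G) = ⊤ →
    ((cayleyGraph (S : Set G)).end).Infinite

/-- A finitely generated group is one-ended: any of its Cayley graphs w.r.t. a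
finite generating set has exactly one end. -/
def OneEnded (G : Type*) [Group G] : Prop :=
  ∀ S : Finset G, Subgroup.closure (S : Set G) = ⊤ →
    Cardinal.mk ((cayleyGraph (S : Set G)).end) = 1

/-- Two finitely generated groups have the same number of ends. -/
def SameNumberOfEnds (G : Type u) (H : Type v) [Group G] [Group H] : Prop :=
  ∀ (S : Finset G) (T : Finset H), Subgroup.closure (S : Set G) = ⊤ →
    Subgroup.closure (T : Set H) = ⊤ →
    Cardinal.lift.{v} (Cardinal.mk ((cayleyGraph (S : Set G)).end)) =
      Cardinal.lift.{u} (Cardinal.mk ((cayleyGraph (T : Set H)).end))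

/-- A finite connected graph of groups: a finite connected graph (with oriented
edges `E`, edge reversal `bar` and initial vertex map `ini`), groups attached to
vertices and edges, and injections of each edge group into the vertex group at
its initial vertex. -/
structure GraphOfGroups where
  /-- the vertex set -/
  V : Type
  /-- the set of oriented edges -/
  E : Type
  fV : Finite V
  fE : Finite E
  /-- reversal of oriented edges -/
  bar : E → E
  bar_invol : ∀ e, bar (bar e) = e
  bar_ne : ∀ e, bar e ≠ e
  /-- the initial vertex of an edge -/
  ini : E → V
  /-- the vertex groups -/
  Gv : V → Type
  [grpV : ∀ v, Group (Gv v)]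
  /-- the edge groups -/
  Ge : E → Type
  [grpE : ∀ e, Group (Ge e)]
  /-- the identification of the edge groups of an edge and its reversal -/
  barEquiv : ∀ e, Ge e ≃* Ge (bar e)
  /-- the inclusion of the edge group into the vertex group of the initial
  vertex -/
  mono : ∀ e, Ge e →* Gv (ini e)
  mono_inj : ∀ e, Function.Injective (mono e)
  /-- the underlying graph is connected -/
  conn : (SimpleGraph.fromRel fun v w => ∃ e, ini e = v ∧ ini (bar e) = w).Connected

attribute [instance] GraphOfGroups.grpV GraphOfGroups.grpE

namespace GraphOfGroups

variable (𝔾 : GraphOfGroups)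

/-- The ambient group of generators for the fundamental group of a graph of
groups: the free product of all vertex groups and the free group on the set of
oriented edges. -/
abbrev Gens : Type :=
  Monoid.Coprod (Monoid.CoprodI 𝔾.Gv) (FreeGroup 𝔾.E)

/-- The defining relators of the fundamental group of a graph of groups with
respect to a spanning tree `T`: for each oriented edge `e` and each `x` in its
edge group, `tₑ⁻¹ (monoₑ x) tₑ (mono_ē x̄)⁻¹`; for each oriented edge `e`,
`t_ē tₑ`; and `tₑ` for every edge `e` of the spanning tree `T`. -/
def rels (T : Set 𝔾.E) : Set 𝔾.Gens :=
  {r | (∃ (e : 𝔾.E) (x : 𝔾.Ge e),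
          r = (Monoid.Coprod.inr (FreeGroup.of e))⁻¹ *
              Monoid.Coprod.inl (Monoid.CoprodI.of (𝔾.mono e x)) *
              Monoid.Coprod.inr (FreeGroup.of e) *
              (Monoid.Coprod.inl (Monoid.CoprodI.of (𝔾.mono (𝔾.bar e) (𝔾.barEquiv e x))))⁻¹) ∨
       (∃ e : 𝔾.E,
          r = Monoid.Coprod.inr (FreeGroup.of (𝔾.bar e)) * Monoid.Coprod.inr (FreeGroup.of e)) ∨
       (∃ e ∈ T, r = Monoid.Coprod.inr (FreeGroup.of e))}

/-- The fundamental group of a graph of groups w.r.t. a spanning tree `T`. -/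
def FundamentalGroup (T : Set 𝔾.E) : Type :=
  𝔾.Gens ⧸ Subgroup.normalClosure (𝔾.rels T)

instance (T : Set 𝔾.E) : Group (𝔾.FundamentalGroup T) :=
  inferInstanceAs (Group (𝔾.Gens ⧸ Subgroup.normalClosure (𝔾.rels T)))

/-- The subgraph of the underlying graph determined by a set `T` of oriented
edges. -/
def subGraph (T : Set 𝔾.E) : SimpleGraph 𝔾.V :=
  SimpleGraph.fromRel fun v w => ∃ e ∈ T, 𝔾.ini e = v ∧ 𝔾.ini (𝔾.bar e) = w

/-- `T` is a spanning tree of the underlying graph: it is closed under edge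
reversal, spans a connected subgraph, and has exactly `|V| - 1` geometric
edges. -/
def IsSpanningTree (T : Set 𝔾.E) : Prop :=
  (∀ e ∈ T, 𝔾.bar e ∈ T) ∧ (𝔾.subGraph T).Connected ∧
    Nat.card T + 2 = 2 * Nat.card 𝔾.V

/-- All edge groups are finite. -/
def FiniteEdgeGroups : Prop :=
  ∀ e : 𝔾.E, Finite (𝔾.Ge e)

/-- The canonical map from a vertex group to the fundamental group. -/
def vertexHom (T : Set 𝔾.E) (v : 𝔾.V) : 𝔾.Gv v →* 𝔾.FundamentalGroup T :=
  ((QuotientGroup.mk' (Subgroup.normalClosure (𝔾.rels T))).comp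
    Monoid.Coprod.inl).comp Monoid.CoprodI.of

end GraphOfGroups

/-- A graph of groups is terminal if all edge groups are finite and every
vertex group is finite or one-ended. -/
def GraphOfGroups.Terminal (𝔾 : GraphOfGroups) : Prop :=
  𝔾.FiniteEdgeGroups ∧ ∀ v : 𝔾.V, Finite (𝔾.Gv v) ∨ OneEnded (𝔾.Gv v)

/-- A finitely generated group is accessible if it admits a terminal
graph-of-groups decomposition. -/
def Accessible (G : Type) [Group G] : Prop :=
  ∃ (𝔾 : GraphOfGroups) (T : Set 𝔾.E), 𝔾.IsSpanningTree T ∧ 𝔾.Terminal ∧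
    Nonempty (G ≃* 𝔾.FundamentalGroup T)

section WordMetric

variable {G : Type*} [Group G]

/-- Letters of the alphabet `S ∪ S⁻¹`. -/
def IsWordIn (S : Set G) (l : List G) : Prop := ∀ x ∈ l, x ∈ S ∨ x⁻¹ ∈ S

theorem wordDist_le {S : Set G} {g h : G} {l : List G} (hl : IsWordIn S l)
    (hp : l.prod = g⁻¹ * h) : wordDist S g h ≤ l.length :=
  Nat.sInf_le ⟨l, rfl, hl, hp⟩

theorem exists_word_of_closure_eq_top {S : Set G} (hS : Subgroup.closure S = ⊤) (g : G) :
    ∃ l : List G, IsWordIn S l ∧ l.prod = g := by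
  have hg : g ∈ Subgroup.closure S := hS ▸ Subgroup.mem_top g
  rw [← Subgroup.mem_toSubmonoid, Subgroup.closure_toSubmonoid] at hg
  obtain ⟨l, hl, hp⟩ := Submonoid.exists_list_of_mem_closure hg
  exact ⟨l, hl, hp⟩

theorem exists_word_length_eq_wordDist {S : Set G} (hS : Subgroup.closure S = ⊤) (g h : G) :
    ∃ l : List G, l.length = wordDist S g h ∧ IsWordIn S l ∧ l.prod = g⁻¹ * h := by
  obtain ⟨l, hl, hp⟩ := exists_word_of_closure_eq_top hS (g⁻¹ * h)
  exact Nat.sInf_mem (s := {n | ∃ l : List G, l.length = n ∧ (∀ x ∈ l, x ∈ S ∨ x⁻¹ ∈ S) ∧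
    l.prod = g⁻¹ * h}) ⟨l.length, l, rfl, hl, hp⟩

theorem wordDist_self (S : Set G) (g : G) : wordDist S g g = 0 :=
  Nat.le_zero.mp (wordDist_le (l := []) (by simp [IsWordIn]) (by simp))

theorem wordDist_mul_left (S : Set G) (k g h : G) :
    wordDist S (k * g) (k * h) = wordDist S g h := by
  simp only [wordDist, mul_inv_rev, mul_assoc, inv_mul_cancel_left]

theorem wordDist_one_inv_mul (S : Set G) (g h : G) :
    wordDist S 1 (g⁻¹ * h) = wordDist S g h := by
  simp [wordDist]

theorem wordDist_comm (S : Set G) (g h : G) : wordDist S g h = wordDist S h g := by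
  have key : ∀ a b : G, ∀ n, (∃ l : List G, l.length = n ∧ (∀ x ∈ l, x ∈ S ∨ x⁻¹ ∈ S) ∧
      l.prod = a⁻¹ * b) → ∃ l : List G, l.length = n ∧ (∀ x ∈ l, x ∈ S ∨ x⁻¹ ∈ S) ∧
      l.prod = b⁻¹ * a := by
    rintro a b n ⟨l, hn, hl, hp⟩
    refine ⟨(l.map (·⁻¹)).reverse, by simpa using hn, fun x hx => ?_, ?_⟩
    · have := hl x⁻¹ (by simpa using hx)
      rwa [inv_inv, or_comm] at this
    · rw [← List.prod_inv_reverse, hp]; simp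
  unfold wordDist
  congr 1
  ext n
  exact ⟨key g h n, key h g n⟩

theorem wordDist_triangle {S : Set G} (hS : Subgroup.closure S = ⊤) (a b c : G) :
    wordDist S a c ≤ wordDist S a b + wordDist S b c := by
  obtain ⟨l, hl, hlS, hlp⟩ := exists_word_length_eq_wordDist hS a b
  obtain ⟨m, hm, hmS, hmp⟩ := exists_word_length_eq_wordDist hS b c
  rw [← hl, ← hm, ← List.length_append]
  refine wordDist_le (fun x hx => ?_) (by rw [List.prod_append, hlp, hmp]; group)
  rcases List.mem_append.mp hx with h | h
  exacts [hlS x h, hmS x h]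

theorem wordDist_le_one {S : Set G} {g h : G} (hs : g⁻¹ * h ∈ S) : wordDist S g h ≤ 1 :=
  wordDist_le (l := [g⁻¹ * h]) (by simp [IsWordIn, hs]) (by simp)

theorem finite_setOf_word_prod {S : Set G} (hS : S.Finite) (n : ℕ) :
    {g : G | ∃ l : List G, l.length = n ∧ IsWordIn S l ∧ l.prod = g}.Finite := by
  induction n with
  | zero =>
    refine (Set.finite_singleton (1 : G)).subset ?_
    rintro g ⟨l, hl, -, rfl⟩
    simp [List.length_eq_zero_iff.mp hl]
  | succ n ih =>
    refine (Set.Finite.image2 (· * ·) (hS.union hS.inv) ih).subset ?_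
    rintro g ⟨l, hl, hlS, rfl⟩
    obtain ⟨x, l, rfl⟩ := List.exists_cons_of_length_eq_add_one hl
    refine ⟨x, hlS x (by simp), l.prod, ⟨l, by simpa using hl, fun y hy => hlS y (by simp [hy]),
      rfl⟩, by simp⟩

theorem finite_wordDist_ball {S : Set G} (hS : S.Finite) (hgen : Subgroup.closure S = ⊤)
    (g : G) (n : ℕ) : {h : G | wordDist S g h ≤ n}.Finite := by
  have hfin : (⋃ m ∈ Set.Iic n, (fun x => g * x) ''
      {x : G | ∃ l : List G, l.length = m ∧ IsWordIn S l ∧ l.prod = x}).Finite :=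
    (Set.finite_Iic n).biUnion fun m _ => (finite_setOf_word_prod hS m).image _
  refine hfin.subset fun h hh => ?_
  obtain ⟨l, hl, hlS, hp⟩ := exists_word_length_eq_wordDist hgen g h
  exact Set.mem_biUnion (x := wordDist S g h) hh ⟨g⁻¹ * h, ⟨l, hl, hlS, hp⟩, by simp⟩

theorem exists_wordDist_bound {A : Set G} (hA : A.Finite) (S : Set G) (g : G) :
    ∃ n : ℕ, ∀ x ∈ A, wordDist S g x ≤ n := by
  obtain ⟨n, hn⟩ := (hA.image (wordDist S g)).bddAbove
  exact ⟨n, fun x hx => hn ⟨x, hx, rfl⟩⟩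

theorem wordDist_map {G' : Type*} [Group G'] (e : G ≃* G') (S : Set G) (a b : G) :
    wordDist (e '' S) (e a) (e b) = wordDist S a b := by
  unfold wordDist
  congr 1
  ext n
  constructor
  · rintro ⟨l, hn, hl, hp⟩
    refine ⟨l.map e.symm, by simpa using hn, fun x hx => ?_, ?_⟩
    · obtain ⟨y, hy, rfl⟩ := List.mem_map.mp hx
      rcases hl y hy with ⟨s, hs, h⟩ | ⟨s, hs, h⟩
      · exact Or.inl (by simpa [← h] using hs)
      · exact Or.inr (by rw [← map_inv, ← h]; simpa using hs)
    · rw [← map_list_prod, hp]; simp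
  · rintro ⟨l, hn, hl, hp⟩
    refine ⟨l.map e, by simpa using hn, fun x hx => ?_, ?_⟩
    · obtain ⟨y, hy, rfl⟩ := List.mem_map.mp hx
      rcases hl y hy with h | h
      · exact Or.inl ⟨y, h, rfl⟩
      · exact Or.inr ⟨y⁻¹, h, map_inv e y⟩
    · rw [← map_list_prod, hp]; simp

end WordMetric

section OneEnded

open CategoryTheory

theorem SimpleGraph.exists_end_through_componentCompl {V : Type} (Γ : SimpleGraph V)
    [Γ.LocallyFinite] (hΓ : Γ.Preconnected) (K : Finset V) (C : Γ.ComponentCompl K)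
    (hC : (C : Set V).Infinite) : ∃ s : Γ.end, s.val (Opposite.op K) = C := by
  have : Fact Γ.Preconnected := ⟨hΓ⟩
  let F := Γ.componentComplFunctor
  have hinf : Infinite V := Set.infinite_univ_iff.mp (hC.mono (Set.subset_univ _))
  have hfin : ∀ j, Finite (F.obj j) := fun j => Γ.componentCompl_finite j.unop
  have hne : ∀ j, Nonempty (F.obj j) := fun j => Γ.componentCompl_nonempty_of_infinite j.unop
  have hML : F.IsMittagLeffler :=
    F.isMittagLeffler_of_exists_finite_range fun j => ⟨j, 𝟙 j, Set.toFinite _⟩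
  have hne' : ∀ j, Nonempty (F.toEventualRanges.obj j) := F.toEventualRanges_nonempty hML
  have hfin' : ∀ j, Finite (F.toEventualRanges.obj j) := fun j => by
    rw [F.toEventualRanges_obj]; infer_instance
  have hmem : C ∈ F.eventualRange (Opposite.op K) := Γ.infinite_iff_in_eventualRange C |>.mp hC
  obtain ⟨s, hs⟩ := F.toEventualRanges.eval_section_surjective_of_surjective
    (F.surjective_toEventualRanges hML) (Opposite.op K) ⟨C, hmem⟩
  exact ⟨F.toEventualRangesSectionsEquiv s, congrArg Subtype.val hs⟩

variable {H : Type} [Group H]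

theorem cayleyGraph_adj {S : Set H} {g h : H} :
    (cayleyGraph S).Adj g h ↔ g ≠ h ∧ (g⁻¹ * h ∈ S ∨ h⁻¹ * g ∈ S) := by
  simp [cayleyGraph]

theorem wordDist_le_one_of_adj {S : Set H} {g h : H} (hadj : (cayleyGraph S).Adj g h) :
    wordDist S g h ≤ 1 := by
  rcases (cayleyGraph_adj.mp hadj).2 with hs | hs
  · exact wordDist_le_one hs
  · rw [wordDist_comm]; exact wordDist_le_one hs

theorem cayleyGraph_reachable_mul {S : Set H} {l : List H} (hl : IsWordIn S l) (g : H) :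
    (cayleyGraph S).Reachable g (g * l.prod) := by
  induction l generalizing g with
  | nil => simp
  | cons x l ih =>
    have h1 : (cayleyGraph S).Reachable g (g * x) := by
      by_cases hx : g = g * x
      · rw [← hx]
      · refine SimpleGraph.Adj.reachable (cayleyGraph_adj.mpr ⟨hx, ?_⟩)
        simpa using hl x (by simp)
    have h2 := ih (fun y hy => hl y (by simp [hy])) (g * x)
    rw [List.prod_cons, ← mul_assoc]
    exact h1.trans h2

theorem cayleyGraph_preconnected {S : Set H} (hS : Subgroup.closure S = ⊤) :
    (cayleyGraph S).Preconnected := by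
  intro g h
  obtain ⟨l, hl, hp⟩ := exists_word_of_closure_eq_top hS (g⁻¹ * h)
  simpa [hp] using cayleyGraph_reachable_mul hl g

/-- In a one-ended group, a set whose boundary is contained in a fixed ball, or its complement, is
contained in a ball of controlled radius. -/
theorem OneEnded.exists_ball_of_boundary_subset_ball (hH : OneEnded H) (S : Finset H)
    (hS : Subgroup.closure (S : Set H) = ⊤) (D : ℕ) :
    ∃ D' : ℕ, ∀ (A : Set H) (c : H),
      (∀ x y, (cayleyGraph (S : Set H)).Adj x y → x ∈ A → y ∉ A →
        wordDist (S : Set H) c x ≤ D ∧ wordDist (S : Set H) c y ≤ D) →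
      (∀ x ∈ A, wordDist (S : Set H) c x ≤ D') ∨ (∀ x ∉ A, wordDist (S : Set H) c x ≤ D') := by
  classical
  set Γ := cayleyGraph (S : Set H) with hΓ
  have hpre : Γ.Preconnected := cayleyGraph_preconnected hS
  have hball := finite_wordDist_ball S.finite_toSet hS (1 : H)
  have : Γ.LocallyFinite := fun v => by
    refine Set.Finite.fintype ((finite_wordDist_ball S.finite_toSet hS v 1).subset fun w hw => ?_)
    exact wordDist_le_one_of_adj hw
  have : Fact Γ.Preconnected := ⟨hpre⟩
  let K : Finset H := (hball D).toFinset
  have hcomp : ∀ C₁ C₂ : Γ.ComponentCompl K, (C₁ : Set H).Infinite → (C₂ : Set H).Infinite →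
      C₁ = C₂ := by
    intro C₁ C₂ h₁ h₂
    obtain ⟨s₁, hs₁⟩ := Γ.exists_end_through_componentCompl hpre K C₁ h₁
    obtain ⟨s₂, hs₂⟩ := Γ.exists_end_through_componentCompl hpre K C₂ h₂
    have hsub : Subsingleton Γ.end := (Cardinal.eq_one_iff_unique.mp (hH S hS)).1
    rw [← hs₁, ← hs₂, hsub.elim s₁ s₂]
  have hcfin : Finite (Γ.ComponentCompl K) := Γ.componentCompl_finite K
  let B : Set H := (K : Set H) ∪ ⋃ C ∈ {C : Γ.ComponentCompl K | (C : Set H).Finite}, (C : Set H)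
  have hB : B.Finite := K.finite_toSet.union
    (Set.Finite.biUnion (Set.toFinite _) fun C hC => hC)
  obtain ⟨D', hD'⟩ := exists_wordDist_bound hB (S : Set H) 1
  have hone : ∀ A : Set H, (∀ x y, Γ.Adj x y → x ∈ A → y ∉ A → x ∈ K ∧ y ∈ K) →
      A ⊆ B ∨ Aᶜ ⊆ B := by
    intro A hA
    have hside : ∀ C : Γ.ComponentCompl K, (C : Set H) ⊆ A ∨ (C : Set H) ⊆ Aᶜ := by
      intro C
      have hmono : ∀ x y, x ∉ K → (hx : x ∉ (K : Set H)) → (hy : y ∉ (K : Set H)) →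
          Γ.componentComplMk hx = Γ.componentComplMk hy → x ∈ A → y ∈ A := by
        intro x y _ hx hy hxy hxA
        have hr : (Γ.induce (K : Set H)ᶜ).Reachable ⟨x, hx⟩ ⟨y, hy⟩ :=
          SimpleGraph.ConnectedComponent.exact hxy
        obtain ⟨p⟩ := hr
        have hwalk : ∀ (u v : ((K : Set H)ᶜ : Set H)), (Γ.induce (K : Set H)ᶜ).Walk u v →
            (u : H) ∈ A → (v : H) ∈ A := by
          intro u v p
          induction p with
          | nil => exact id
          | @cons u v w h p ih =>
            intro hu
            refine ih ?_
            by_contra hv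
            exact u.2 (hA u v (by simpa using h) hu hv).1
        exact hwalk _ _ p hxA
      by_contra hcon
      push Not at hcon
      obtain ⟨h1, h2⟩ := hcon
      obtain ⟨y, hyC, hyA⟩ := Set.not_subset.mp h1
      obtain ⟨x, hxC, hxA⟩ := Set.not_subset.mp h2
      obtain ⟨hx, hxe⟩ := SimpleGraph.ComponentCompl.mem_supp_iff.mp hxC
      obtain ⟨hy, hye⟩ := SimpleGraph.ComponentCompl.mem_supp_iff.mp hyC
      exact hyA (hmono x y hx hx hy (hxe.trans hye.symm) (not_not.mp hxA))
    have hcov : ∀ A' : Set H, (∀ C : Γ.ComponentCompl K, (C : Set H).Infinite →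
        (C : Set H) ⊆ A'ᶜ) → A' ⊆ B := by
      intro A' hA' x hx
      by_cases hxK : x ∈ (K : Set H)
      · exact Or.inl hxK
      · right
        have hxC : x ∈ (Γ.componentComplMk hxK : Set H) := Γ.componentComplMk_mem hxK
        refine Set.mem_biUnion (x := Γ.componentComplMk hxK) ?_ hxC
        by_contra hinf
        exact hA' _ hinf hxC hx
    by_cases hex : ∃ C : Γ.ComponentCompl K, (C : Set H).Infinite ∧ (C : Set H) ⊆ A
    · obtain ⟨C, hC, hCA⟩ := hex
      right
      refine hcov _ fun C' hC' => ?_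
      rw [hcomp C' C hC' hC, compl_compl]
      exact hCA
    · push Not at hex
      left
      exact hcov _ fun C' hC' => (hside C').resolve_left (hex C' hC')
  refine ⟨D', fun A c hA => ?_⟩
  have hadj : ∀ x y, Γ.Adj x y → Γ.Adj (c * x) (c * y) := by
    intro x y hxy
    rw [hΓ, cayleyGraph_adj] at hxy ⊢
    simpa [mul_assoc] using hxy
  have hdist : ∀ x, wordDist (S : Set H) c x = wordDist (S : Set H) 1 (c⁻¹ * x) := fun x =>
    (wordDist_one_inv_mul _ c x).symm
  rcases hone {x | c * x ∈ A} (fun x y hxy hx hy => by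
    simpa [K, hdist] using hA _ _ (hadj x y hxy) hx hy) with h | h
  · left
    intro x hx
    rw [hdist]
    exact hD' _ (h (by simpa using hx))
  · right
    intro x hx
    rw [hdist]
    exact hD' _ (h (by simpa using hx))

end OneEnded

theorem ZMod.add_eq_zero_iff_eq_of_two {x y : ZMod 2} : x + y = 0 ↔ x = y := by
  revert x y; decide

namespace GraphOfGroups

variable (𝔾 : GraphOfGroups) {T : Set 𝔾.E}

theorem eq_of_forall_edge_eq {α : Type*} (hT : 𝔾.IsSpanningTree T) {π : 𝔾.V → α}
    (hπ : ∀ e ∈ T, π (𝔾.ini e) = π (𝔾.ini (𝔾.bar e))) (v w : 𝔾.V) : π v = π w := by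
  obtain ⟨p⟩ := hT.2.1.preconnected v w
  induction p with
  | nil => rfl
  | cons h p ih =>
    rw [← ih]
    rcases (SimpleGraph.fromRel_adj _ _ _).mp h with ⟨-, ⟨e, he, rfl, rfl⟩ | ⟨e, he, rfl, rfl⟩⟩
    exacts [hπ e he, (hπ e he).symm]

/-- Every edge of the spanning tree separates it: there is a function on the vertices, with values
in `ZMod 2`, which changes exactly along this edge. -/
theorem exists_potential (hT : 𝔾.IsSpanningTree T) (a : 𝔾.E) :
    ∃ π : 𝔾.V → ZMod 2, ∀ e ∈ T,
      (π (𝔾.ini e) ≠ π (𝔾.ini (𝔾.bar e)) ↔ e = a ∨ e = 𝔾.bar a) := by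
  classical
  by_cases haT : a ∈ T
  swap
  · refine ⟨0, fun e he => ?_⟩
    simp only [Pi.zero_apply, ne_eq, not_true_eq_false, false_iff, not_or]
    refine ⟨fun h => haT (h ▸ he), fun h => haT ?_⟩
    rw [← 𝔾.bar_invol a, ← h]
    exact hT.1 e he
  have := 𝔾.fV
  have := 𝔾.fE
  have := Fintype.ofFinite 𝔾.V
  have := Fintype.ofFinite 𝔾.E
  let n := Fintype.equivFin 𝔾.E
  let P : Set 𝔾.E := {e | e ∈ T ∧ n e < n (𝔾.bar e)}
  have hdisj : Disjoint P (𝔾.bar '' P) := by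
    rw [Set.disjoint_left]
    rintro _ h ⟨e, he, rfl⟩
    have h1 := h.2
    rw [𝔾.bar_invol] at h1
    exact lt_asymm h1 he.2
  have hunion : P ∪ 𝔾.bar '' P = T := by
    ext e
    constructor
    · rintro (h | ⟨e, he, rfl⟩)
      exacts [h.1, hT.1 _ he.1]
    · intro he
      rcases lt_trichotomy (n e) (n (𝔾.bar e)) with h | h | h
      · exact Or.inl ⟨he, h⟩
      · exact absurd (n.injective h).symm (𝔾.bar_ne e)
      · exact Or.inr ⟨𝔾.bar e, ⟨hT.1 e he, by rwa [𝔾.bar_invol]⟩, 𝔾.bar_invol e⟩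
  have hinj : Function.Injective 𝔾.bar := Function.Involutive.injective 𝔾.bar_invol
  have hcard : Nat.card T = 2 * Nat.card P := by
    rw [← hunion, Nat.card_coe_set_eq, Set.ncard_union_eq hdisj, Set.ncard_image_of_injective _ hinj,
      Nat.card_coe_set_eq, two_mul]
  have hcardP : Nat.card P + 1 = Nat.card 𝔾.V := by
    have := hT.2.2
    omega
  let d : (𝔾.V → ZMod 2) →ₗ[ZMod 2] (P → ZMod 2) :=
    { toFun := fun π e => π (𝔾.ini e) + π (𝔾.ini (𝔾.bar e))
      map_add' := fun π ρ => by ext e; simp only [Pi.add_apply]; ring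
      map_smul' := fun c π => by ext e; simp [mul_add] }
  have hker : LinearMap.ker d ≤ Submodule.span (ZMod 2) {(1 : 𝔾.V → ZMod 2)} := by
    intro π hπ
    have hP : ∀ e ∈ P, π (𝔾.ini e) = π (𝔾.ini (𝔾.bar e)) := fun e he =>
      ZMod.add_eq_zero_iff_eq_of_two.mp (congrFun (LinearMap.mem_ker.mp hπ) ⟨e, he⟩)
    have hTe : ∀ e ∈ T, π (𝔾.ini e) = π (𝔾.ini (𝔾.bar e)) := by
      intro e he
      rw [← hunion] at he
      rcases he with he | ⟨e, he, rfl⟩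
      · exact hP e he
      · rw [𝔾.bar_invol]; exact (hP e he).symm
    rw [Submodule.mem_span_singleton]
    refine ⟨π (𝔾.ini a), ?_⟩
    ext v
    simpa using 𝔾.eq_of_forall_edge_eq hT hTe (𝔾.ini a) v
  have hsurj : LinearMap.range d = ⊤ := by
    apply Submodule.eq_top_of_finrank_eq
    have h1 := d.finrank_range_add_finrank_ker
    have h2 : Module.finrank (ZMod 2) (LinearMap.ker d) ≤ 1 :=
      (Submodule.finrank_mono hker).trans
        (by simpa using finrank_span_le_card (R := ZMod 2) {(1 : 𝔾.V → ZMod 2)})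
    have h3 := Submodule.finrank_le (LinearMap.range d)
    rw [Module.finrank_fintype_fun_eq_card, ← Nat.card_eq_fintype_card] at h1 h3
    rw [Module.finrank_fintype_fun_eq_card, ← Nat.card_eq_fintype_card]
    omega
  obtain ⟨π, hπ⟩ := LinearMap.range_eq_top.mp hsurj
    fun e => if (e : 𝔾.E) = a ∨ (e : 𝔾.E) = 𝔾.bar a then 1 else 0
  have hP : ∀ e ∈ P, (π (𝔾.ini e) ≠ π (𝔾.ini (𝔾.bar e)) ↔ e = a ∨ e = 𝔾.bar a) := by
    intro e he
    have h := congrFun hπ ⟨e, he⟩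
    rw [ne_eq, ← ZMod.add_eq_zero_iff_eq_of_two]
    change π (𝔾.ini e) + π (𝔾.ini (𝔾.bar e)) = _ at h
    rw [h, ite_eq_right_iff]
    simp [-not_or]
  refine ⟨π, fun e he => ?_⟩
  rw [← hunion] at he
  rcases he with he | ⟨e, he, rfl⟩
  · exact hP e he
  · rw [𝔾.bar_invol, ne_comm, hP e he, hinj.eq_iff, or_comm]
    exact or_congr_left (by rw [← hinj.eq_iff, 𝔾.bar_invol])

end GraphOfGroups

/-- The permutation `(y, s) ↦ (y * g⁻¹, s + c (y * g⁻¹))`. -/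
def twistedTranslation {Γ : Type*} [Group Γ] (c : Γ → ZMod 2) (g : Γ) :
    Equiv.Perm (Γ × ZMod 2) where
  toFun p := (p.1 * g⁻¹, p.2 + c (p.1 * g⁻¹))
  invFun p := (p.1 * g, p.2 - c p.1)
  left_inv p := by simp
  right_inv p := by simp

section TwistedTranslation

variable {Γ : Type*} [Group Γ]

theorem twistedTranslation_mul (c d : Γ → ZMod 2) (g h : Γ) :
    twistedTranslation c g * twistedTranslation d h =
      twistedTranslation (fun z => c z + d (z * g)) (g * h) := by
  ext p
  · simp [twistedTranslation, mul_assoc]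
  · simp [twistedTranslation, mul_assoc]
    ring

theorem twistedTranslation_zero_one : twistedTranslation (fun _ : Γ => 0) 1 = 1 := by
  ext p <;> simp [twistedTranslation]

theorem twistedTranslation_inv (c : Γ → ZMod 2) (g : Γ) :
    (twistedTranslation c g)⁻¹ = twistedTranslation (fun z => - c (z * g⁻¹)) g⁻¹ := by
  rw [inv_eq_iff_mul_eq_one, twistedTranslation_mul, ← twistedTranslation_zero_one]
  congr 1 <;> simp [CharTwo.add_self_eq_zero]

theorem twistedTranslation_left_injective {c d : Γ → ZMod 2} {g : Γ}
    (h : twistedTranslation c g = twistedTranslation d g) : c = d := by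
  ext z
  simpa [twistedTranslation] using congrArg Prod.snd (Equiv.congr_fun h (z * g, 0))

end TwistedTranslation

namespace GraphOfGroups

variable (𝔾 : GraphOfGroups) (T : Set 𝔾.E)

/-- The stable letter of an edge. -/
def stableLetter (e : 𝔾.E) : 𝔾.FundamentalGroup T :=
  QuotientGroup.mk' (Subgroup.normalClosure (𝔾.rels T)) (Monoid.Coprod.inr (FreeGroup.of e))

/-- The image of the group of the edge `e` in the fundamental group, through the initial vertex. -/
def edgeSubgroup (e : 𝔾.E) : Subgroup (𝔾.FundamentalGroup T) :=
  ((𝔾.vertexHom T (𝔾.ini e)).comp (𝔾.mono e)).range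

theorem mk_eq_one_of_mem_rels {r : 𝔾.Gens} (hr : r ∈ 𝔾.rels T) :
    QuotientGroup.mk' (Subgroup.normalClosure (𝔾.rels T)) r = 1 :=
  (QuotientGroup.eq_one_iff _).mpr (Subgroup.subset_normalClosure hr)

theorem vertexHom_mono_mul_stableLetter (e : 𝔾.E) (x : 𝔾.Ge e) :
    𝔾.vertexHom T (𝔾.ini e) (𝔾.mono e x) * 𝔾.stableLetter T e =
      𝔾.stableLetter T e *
        𝔾.vertexHom T (𝔾.ini (𝔾.bar e)) (𝔾.mono (𝔾.bar e) (𝔾.barEquiv e x)) := by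
  have h := 𝔾.mk_eq_one_of_mem_rels T (Or.inl ⟨e, x, rfl⟩)
  rw [map_mul, map_mul, map_mul, map_inv, map_inv, mul_inv_eq_one, mul_assoc,
    inv_mul_eq_iff_eq_mul] at h
  exact h

theorem stableLetter_bar_mul (e : 𝔾.E) : 𝔾.stableLetter T (𝔾.bar e) * 𝔾.stableLetter T e = 1 := by
  have h := 𝔾.mk_eq_one_of_mem_rels T (Or.inr (Or.inl ⟨e, rfl⟩))
  rwa [map_mul] at h

theorem stableLetter_bar (e : 𝔾.E) : 𝔾.stableLetter T (𝔾.bar e) = (𝔾.stableLetter T e)⁻¹ :=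
  eq_inv_of_mul_eq_one_left (𝔾.stableLetter_bar_mul T e)

variable {T} in
theorem stableLetter_eq_one {e : 𝔾.E} (he : e ∈ T) : 𝔾.stableLetter T e = 1 :=
  𝔾.mk_eq_one_of_mem_rels T (Or.inr (Or.inr ⟨e, he, rfl⟩))

theorem subgroup_eq_top {P : Subgroup (𝔾.FundamentalGroup T)}
    (hV : ∀ v x, 𝔾.vertexHom T v x ∈ P) (hE : ∀ e, 𝔾.stableLetter T e ∈ P) : P = ⊤ := by
  let q := QuotientGroup.mk' (Subgroup.normalClosure (𝔾.rels T))
  have hq : ∀ x : 𝔾.Gens, q x ∈ P := by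
    intro x
    induction x using Monoid.Coprod.induction_on with
    | inl m =>
      induction m using Monoid.CoprodI.induction_on with
      | one => rw [map_one, map_one]; exact P.one_mem
      | of v m => exact hV v m
      | mul x y hx hy => rw [map_mul, map_mul]; exact P.mul_mem hx hy
    | inr n =>
      induction n using FreeGroup.induction_on with
      | C1 => rw [map_one, map_one]; exact P.one_mem
      | of e => exact hE e
      | inv_of e h => rw [map_inv, map_inv]; exact P.inv_mem h
      | mul x y hx hy => rw [map_mul, map_mul]; exact P.mul_mem hx hy
    | mul x y hx hy => rw [map_mul]; exact P.mul_mem hx hy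
  refine (Subgroup.eq_top_iff' P).mpr fun g => ?_
  obtain ⟨x, rfl⟩ := QuotientGroup.mk'_surjective _ g
  exact hq x

theorem mul_vertexHom_mono_mem_iff (a : 𝔾.E) (x : 𝔾.Ge a) (z : 𝔾.FundamentalGroup T) :
    z * 𝔾.vertexHom T (𝔾.ini a) (𝔾.mono a x) ∈ 𝔾.edgeSubgroup T a ↔ z ∈ 𝔾.edgeSubgroup T a :=
  Subgroup.mul_mem_cancel_right _ ⟨x, rfl⟩

open Classical in
/-- The contribution of the oriented edge `e`, started at `z`, to the number of crossings of the
edge of the Bass–Serre tree given by the trivial coset of the group of `a`. -/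
noncomputable def crossing (a e : 𝔾.E) (z : 𝔾.FundamentalGroup T) : ZMod 2 :=
  if (e = a ∧ z ∈ 𝔾.edgeSubgroup T a) ∨
    (e = 𝔾.bar a ∧ z * 𝔾.stableLetter T e ∈ 𝔾.edgeSubgroup T a) then 1 else 0

theorem crossing_mul_mono (a e : 𝔾.E) (x : 𝔾.Ge e) (z : 𝔾.FundamentalGroup T) :
    𝔾.crossing T a e (z * 𝔾.vertexHom T (𝔾.ini e) (𝔾.mono e x)) = 𝔾.crossing T a e z := by
  have h1 : (e = a ∧ z * 𝔾.vertexHom T (𝔾.ini e) (𝔾.mono e x) ∈ 𝔾.edgeSubgroup T a) ↔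
      (e = a ∧ z ∈ 𝔾.edgeSubgroup T a) := by
    refine and_congr_right ?_
    rintro rfl
    exact 𝔾.mul_vertexHom_mono_mem_iff T e x z
  have h2 : (e = 𝔾.bar a ∧ z * 𝔾.vertexHom T (𝔾.ini e) (𝔾.mono e x) * 𝔾.stableLetter T e ∈
      𝔾.edgeSubgroup T a) ↔
      (e = 𝔾.bar a ∧ z * 𝔾.stableLetter T e ∈ 𝔾.edgeSubgroup T a) := by
    refine and_congr_right fun h => ?_
    obtain rfl : a = 𝔾.bar e := by rw [h, 𝔾.bar_invol]
    rw [mul_assoc, vertexHom_mono_mul_stableLetter, ← mul_assoc]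
    exact 𝔾.mul_vertexHom_mono_mem_iff T (𝔾.bar e) _ _
  classical
  exact if_congr (or_congr h1 h2) rfl rfl

theorem bar_inj {e e' : 𝔾.E} : 𝔾.bar e = 𝔾.bar e' ↔ e = e' :=
  (Function.Involutive.injective 𝔾.bar_invol).eq_iff

theorem bar_eq_iff {e e' : 𝔾.E} : 𝔾.bar e = e' ↔ e = 𝔾.bar e' :=
  Function.Involutive.eq_iff 𝔾.bar_invol

theorem crossing_bar (a e : 𝔾.E) (z : 𝔾.FundamentalGroup T) :
    𝔾.crossing T a (𝔾.bar e) z = 𝔾.crossing T a e (z * 𝔾.stableLetter T (𝔾.bar e)) := by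
  have h : z * 𝔾.stableLetter T (𝔾.bar e) * 𝔾.stableLetter T e = z := by
    rw [mul_assoc, stableLetter_bar_mul, mul_one]
  classical
  refine if_congr ?_ rfl rfl
  rw [h, 𝔾.bar_inj, 𝔾.bar_eq_iff, or_comm]

variable {T} in
/-- The sides of an edge of the Bass–Serre tree. -/
theorem exists_side (hT : 𝔾.IsSpanningTree T) (a : 𝔾.E) :
    ∃ s : 𝔾.V → 𝔾.FundamentalGroup T → ZMod 2,
      (∀ v g x, s v (g * 𝔾.vertexHom T v x) = s v g) ∧
      (∀ e g, s (𝔾.ini (𝔾.bar e)) (g * 𝔾.stableLetter T e) =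
        s (𝔾.ini e) g + 𝔾.crossing T a e g) := by
  classical
  obtain ⟨π, hπ⟩ := 𝔾.exists_potential hT a
  let p : 𝔾.V → 𝔾.FundamentalGroup T → ZMod 2 :=
    fun v z => if z ∈ 𝔾.edgeSubgroup T a then π v else 0
  have two : ∀ x : ZMod 2, x + x = 0 := by decide
  let φV : ∀ v, 𝔾.Gv v →* Equiv.Perm (𝔾.FundamentalGroup T × ZMod 2) := fun v =>
    { toFun := fun x => twistedTranslation
        (fun z => p v z + p v (z * 𝔾.vertexHom T v x)) (𝔾.vertexHom T v x)
      map_one' := by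
        rw [← twistedTranslation_zero_one]
        simp only [map_one, mul_one, two]
      map_mul' := fun x y => by
        rw [twistedTranslation_mul, map_mul]
        congr 1
        ext z
        rw [← mul_assoc]
        linear_combination - two (p v (z * 𝔾.vertexHom T v x)) }
  let φE : 𝔾.E → Equiv.Perm (𝔾.FundamentalGroup T × ZMod 2) := fun e => twistedTranslation
    (fun z => p (𝔾.ini e) z + 𝔾.crossing T a e z +
      p (𝔾.ini (𝔾.bar e)) (z * 𝔾.stableLetter T e)) (𝔾.stableLetter T e)
  let φ : 𝔾.Gens →* Equiv.Perm (𝔾.FundamentalGroup T × ZMod 2) :=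
    Monoid.Coprod.lift (Monoid.CoprodI.lift φV) (FreeGroup.lift φE)
  have hφV : ∀ v x, φ (Monoid.Coprod.inl (Monoid.CoprodI.of (i := v) x)) = φV v x := by
    intro v x; simp [φ]
  have hφE : ∀ e, φ (Monoid.Coprod.inr (FreeGroup.of e)) = φE e := by
    intro e; simp [φ]
  have hrels : Subgroup.normalClosure (𝔾.rels T) ≤ φ.ker := by
    refine Subgroup.normalClosure_le_normal ?_
    rintro r (⟨e, x, rfl⟩ | ⟨e, rfl⟩ | ⟨e, he, rfl⟩)
    · rw [SetLike.mem_coe, MonoidHom.mem_ker, map_mul, map_mul, map_mul, map_inv, map_inv,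
        mul_inv_eq_one, mul_assoc, inv_mul_eq_iff_eq_mul, hφV, hφE, hφV]
      change twistedTranslation _ _ * twistedTranslation _ _ =
        twistedTranslation _ _ * twistedTranslation _ _
      rw [twistedTranslation_mul, twistedTranslation_mul, vertexHom_mono_mul_stableLetter]
      congr 1
      ext z
      rw [crossing_mul_mono, mul_assoc z (𝔾.vertexHom T _ _) (𝔾.stableLetter T e),
        vertexHom_mono_mul_stableLetter, ← mul_assoc]
      linear_combination two (p (𝔾.ini e) (z * 𝔾.vertexHom T (𝔾.ini e) (𝔾.mono e x))) -
        two (p (𝔾.ini (𝔾.bar e)) (z * 𝔾.stableLetter T e))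
    · rw [SetLike.mem_coe, MonoidHom.mem_ker, map_mul, hφE, hφE]
      change twistedTranslation _ _ * twistedTranslation _ _ = 1
      rw [twistedTranslation_mul, ← twistedTranslation_zero_one, stableLetter_bar_mul]
      congr 1
      ext z
      rw [crossing_bar, 𝔾.bar_invol, mul_assoc, stableLetter_bar_mul, mul_one]
      linear_combination two (p (𝔾.ini (𝔾.bar e)) z) +
        two (p (𝔾.ini e) (z * 𝔾.stableLetter T (𝔾.bar e))) +
        two (𝔾.crossing T a e (z * 𝔾.stableLetter T (𝔾.bar e)))
    · rw [SetLike.mem_coe, MonoidHom.mem_ker, hφE]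
      change twistedTranslation _ _ = 1
      rw [← twistedTranslation_zero_one, 𝔾.stableLetter_eq_one he]
      congr 1
      ext z
      have h := hπ e he
      simp only [mul_one, p, crossing, 𝔾.stableLetter_eq_one he, ← or_and_right, ← h]
      by_cases hz : z ∈ 𝔾.edgeSubgroup T a
      · simp only [hz, if_true, and_true]
        generalize π (𝔾.ini e) = x
        generalize π (𝔾.ini (𝔾.bar e)) = y
        revert x y
        decide
      · simp [hz]
  let Φ : 𝔾.FundamentalGroup T →* Equiv.Perm (𝔾.FundamentalGroup T × ZMod 2) :=
    QuotientGroup.lift _ φ hrels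
  have hΦV : ∀ v x, Φ (𝔾.vertexHom T v x) = φV v x := hφV
  have hΦE : ∀ e, Φ (𝔾.stableLetter T e) = φE e := hφE
  have hex : ∀ g, ∃ c, Φ g = twistedTranslation c g := by
    let P : Subgroup (𝔾.FundamentalGroup T) :=
      { carrier := {g | ∃ c, Φ g = twistedTranslation c g}
        mul_mem' := by
          rintro g h ⟨c, hc⟩ ⟨d, hd⟩
          exact ⟨_, by rw [map_mul, hc, hd, twistedTranslation_mul]⟩
        one_mem' := ⟨_, by rw [map_one, ← twistedTranslation_zero_one]⟩
        inv_mem' := by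
          rintro g ⟨c, hc⟩
          exact ⟨_, by rw [map_inv, hc, twistedTranslation_inv]⟩ }
    have hP : P = ⊤ := 𝔾.subgroup_eq_top T (fun v x =>
      ⟨fun z => p v z + p v (z * 𝔾.vertexHom T v x), hΦV v x⟩) fun e => ⟨_, hΦE e⟩
    exact fun g => (hP ▸ Subgroup.mem_top g : g ∈ P)
  choose c hc using hex
  have hmul : ∀ g h, c (g * h) 1 = c g 1 + c h g := by
    intro g h
    have h1 : c (g * h) = fun z => c g z + c h (z * g) := by
      apply twistedTranslation_left_injective (g := g * h)
      rw [← twistedTranslation_mul, ← hc, ← hc, ← hc, map_mul]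
    simp [h1]
  refine ⟨fun v g => c g 1 + p v g, fun v g x => ?_, fun e g => ?_⟩
  · have h1 : c (𝔾.vertexHom T v x) = fun z => p v z + p v (z * 𝔾.vertexHom T v x) :=
      twistedTranslation_left_injective ((hc _).symm.trans (hΦV v x))
    beta_reduce
    rw [hmul, h1]
    linear_combination two (p v (g * 𝔾.vertexHom T v x))
  · have h1 : c (𝔾.stableLetter T e) = fun z => p (𝔾.ini e) z + 𝔾.crossing T a e z +
        p (𝔾.ini (𝔾.bar e)) (z * 𝔾.stableLetter T e) :=
      twistedTranslation_left_injective ((hc _).symm.trans (hΦE e))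
    beta_reduce
    rw [hmul, h1]
    linear_combination two (p (𝔾.ini (𝔾.bar e)) (g * 𝔾.stableLetter T e))

end GraphOfGroups

section EdgeSides

variable {X Y : Type*} {ini ter : X → Y} {σ : X → Y → ZMod 2}

theorem ZMod.eq_of_ne_of_ne_of_two {x y z : ZMod 2} (hxy : x ≠ y) (hyz : y ≠ z) : x = z := by
  revert x y z; decide

/-- In a tree, two distinct vertices `p` and `q` are separated by an edge at `p`. The tree is given
by a connected graph together with the functions `σ ε` on its vertices, for all edges `ε`, which
only change along `ε` itself. -/
theorem exists_edge_separating
    (hends : ∀ ε η, σ ε (ini η) ≠ σ ε (ter η) →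
      (ini ε = ini η ∧ ter ε = ter η) ∨ (ini ε = ter η ∧ ter ε = ini η))
    (hconn : ∀ P : Y → Prop, (∀ η, P (ini η) ↔ P (ter η)) → ∀ p q, P p → P q) (p q : Y) :
    q = p ∨ ∃ η, (ini η = p ∨ ter η = p) ∧
      ∀ ε, σ ε (ini η) ≠ σ ε (ter η) → σ ε p ≠ σ ε q := by
  let P : Y → Prop := fun q => q = p ∨ ∃ η, (ini η = p ∨ ter η = p) ∧
      ∀ ε, σ ε (ini η) ≠ σ ε (ter η) → σ ε p ≠ σ ε q
  have step : ∀ ζ q q', ((q = ini ζ ∧ q' = ter ζ) ∨ (q = ter ζ ∧ q' = ini ζ)) → P q → P q' := by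
    intro ζ q q' hζ hq
    have hjump : ∀ ε, σ ε q ≠ σ ε q' ↔ σ ε (ini ζ) ≠ σ ε (ter ζ) := by
      intro ε
      rcases hζ with ⟨rfl, rfl⟩ | ⟨rfl, rfl⟩
      exacts [Iff.rfl, ne_comm]
    by_cases hqp : q = p
    · right
      refine ⟨ζ, ?_, fun ε hε => ?_⟩
      · rcases hζ with ⟨h, -⟩ | ⟨h, -⟩
        exacts [Or.inl (h.symm.trans hqp), Or.inr (h.symm.trans hqp)]
      · rw [← hqp]; exact (hjump ε).mpr hε
    · obtain ⟨η, hη, hsep⟩ := hq.resolve_left hqp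
      by_cases hex : ∃ ε, σ ε (ini η) ≠ σ ε (ter η) ∧ σ ε (ini ζ) ≠ σ ε (ter ζ)
      · obtain ⟨ε, h1, h2⟩ := hex
        left
        have e1 := hends ε η h1
        have e2 := hends ε ζ h2
        grind
      · push Not at hex
        right
        refine ⟨η, hη, fun ε hε => ?_⟩
        have hqq : σ ε q = σ ε q' := by
          by_contra h
          exact (hjump ε).mp h (hex ε hε)
        rw [← hqq]
        exact hsep ε hε
  exact hconn P (fun η => ⟨step η _ _ (Or.inl ⟨rfl, rfl⟩), step η _ _ (Or.inr ⟨rfl, rfl⟩)⟩) p q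
    (Or.inl rfl)

/-- Suppose that every edge `ε` of a tree has a distinguished side `b ε`, and that some vertex lies
on the distinguished side of only finitely many edges. Then there is a vertex `p` such that every
other vertex lies on the distinguished side of some edge at `p`. -/
theorem exists_vertex_forall_distinguished_side
    (hends : ∀ ε η, σ ε (ini η) ≠ σ ε (ter η) →
      (ini ε = ini η ∧ ter ε = ter η) ∨ (ini ε = ter η ∧ ter ε = ini η))
    (hconn : ∀ P : Y → Prop, (∀ η, P (ini η) ↔ P (ter η)) → ∀ p q, P p → P q)
    (hself : ∀ η, σ η (ini η) ≠ σ η (ter η))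
    (hfin : ∀ η, {ε | σ ε (ini η) ≠ σ ε (ter η)}.Finite)
    (b : X → ZMod 2) (p₀ : Y) (hp₀ : {ε | σ ε p₀ = b ε}.Finite) :
    ∃ p, ∀ q, q = p ∨ ∃ ε, (ini ε = p ∨ ter ε = p) ∧ σ ε q = b ε := by
  let N : Y → Set X := fun p => {ε | σ ε p = b ε}
  have hNfin : ∀ p, (N p).Finite := by
    intro p
    refine hconn (fun p => (N p).Finite) (fun η => ⟨fun h => ?_, fun h => ?_⟩) p₀ p hp₀
    · refine (h.union (hfin η)).subset fun ε hε => ?_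
      by_cases hj : σ ε (ini η) = σ ε (ter η)
      exacts [Or.inl (hj.trans hε), Or.inr hj]
    · refine (h.union (hfin η)).subset fun ε hε => ?_
      by_cases hj : σ ε (ini η) = σ ε (ter η)
      exacts [Or.inl (hj.symm.trans hε), Or.inr hj]
  have : Nonempty Y := ⟨p₀⟩
  obtain ⟨p, hp⟩ : ∃ p, ∀ q, (N p).ncard ≤ (N q).ncard :=
    ⟨Function.argmin fun p => (N p).ncard, fun q => Function.argmin_le (fun p => (N p).ncard) q⟩
  refine ⟨p, fun q => ?_⟩
  rcases exists_edge_separating hends hconn p q with hq | ⟨η, hη, hsep⟩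
  · exact Or.inl hq
  right
  by_contra hcon
  push Not at hcon
  obtain ⟨p', hp'⟩ : ∃ p', (ini η = p ∧ ter η = p') ∨ (ter η = p ∧ ini η = p') := by
    rcases hη with h | h
    exacts [⟨_, Or.inl ⟨h, rfl⟩⟩, ⟨_, Or.inr ⟨h, rfl⟩⟩]
  have hjump : ∀ ε, σ ε p ≠ σ ε p' ↔ σ ε (ini η) ≠ σ ε (ter η) := by
    intro ε
    rcases hp' with ⟨rfl, rfl⟩ | ⟨rfl, rfl⟩
    exacts [Iff.rfl, ne_comm]
  have hjb : ∀ ε, σ ε (ini η) ≠ σ ε (ter η) → σ ε p = b ε := by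
    intro ε hε
    refine ZMod.eq_of_ne_of_ne_of_two (hsep ε hε) (hcon ε ?_)
    have := hends ε η hε
    grind
  refine (hp p').not_gt (Set.ncard_lt_ncard ?_ (hNfin p))
  refine Set.ssubset_iff_subset_ne.mpr ⟨fun ε hε => ?_, fun heq => ?_⟩
  · by_cases hj : σ ε p = σ ε p'
    · exact hj.trans hε
    · exact hjb ε ((hjump ε).mp hj)
  · have h1 : η ∈ N p' := heq ▸ (hjb η (hself η) : η ∈ N p)
    exact (hjump η).mpr (hself η) ((hjb η (hself η)).trans h1.symm)

end EdgeSides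

namespace GraphOfGroups

open Filter

variable (𝔾 : GraphOfGroups) {T : Set 𝔾.E}

theorem finite_edgeSubgroup (hfin : 𝔾.FiniteEdgeGroups) (e : 𝔾.E) :
    (𝔾.edgeSubgroup T e : Set (𝔾.FundamentalGroup T)).Finite := by
  have := hfin e
  exact Set.finite_range ((𝔾.vertexHom T (𝔾.ini e)).comp (𝔾.mono e))

theorem crossing_ne_zero_iff {a e : 𝔾.E} {z : 𝔾.FundamentalGroup T} :
    𝔾.crossing T a e z ≠ 0 ↔ (e = a ∧ z ∈ 𝔾.edgeSubgroup T a) ∨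
      (e = 𝔾.bar a ∧ z * 𝔾.stableLetter T e ∈ 𝔾.edgeSubgroup T a) := by
  simp [crossing, -not_or]

theorem crossing_eventuallyEq_zero (hfin : 𝔾.FiniteEdgeGroups) (a e : 𝔾.E) :
    𝔾.crossing T a e =ᶠ[cofinite] 0 := by
  have h := 𝔾.finite_edgeSubgroup (T := T) hfin a
  refine (h.union (h.preimage
    (mul_left_injective (𝔾.stableLetter T e)).injOn)).subset fun z hz => ?_
  rcases 𝔾.crossing_ne_zero_iff.mp hz with h | h
  exacts [Or.inl h.2, Or.inr h.2]

/-- A side of an edge of the Bass–Serre tree is an almost invariant set. -/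
theorem side_mul_eventuallyEq (hT : 𝔾.IsSpanningTree T) (hfin : 𝔾.FiniteEdgeGroups) {a : 𝔾.E}
    {s : 𝔾.V → 𝔾.FundamentalGroup T → ZMod 2}
    (hsV : ∀ v g x, s v (g * 𝔾.vertexHom T v x) = s v g)
    (hsE : ∀ e g, s (𝔾.ini (𝔾.bar e)) (g * 𝔾.stableLetter T e) =
      s (𝔾.ini e) g + 𝔾.crossing T a e g) (v : 𝔾.V) (z : 𝔾.FundamentalGroup T) :
    (fun y => s v (y * z)) =ᶠ[cofinite] s v := by
  have hcross : ∀ e, (fun y => s (𝔾.ini (𝔾.bar e)) (y * 𝔾.stableLetter T e)) =ᶠ[cofinite]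
      s (𝔾.ini e) := fun e => by
    filter_upwards [𝔾.crossing_eventuallyEq_zero (T := T) hfin a e] with y hy
    rw [hsE, hy, Pi.zero_apply, add_zero]
  have htend : ∀ x : 𝔾.FundamentalGroup T, Tendsto (fun y => y * x) cofinite cofinite := fun x =>
    (mul_left_injective x).tendsto_cofinite
  have hVW : ∀ v w, s v =ᶠ[cofinite] s w := by
    intro v w
    rw [← Germ.coe_eq]
    refine 𝔾.eq_of_forall_edge_eq hT (π := fun v => (Germ.ofFun (s v) : Germ cofinite (ZMod 2)))
      (fun e he => ?_) v w
    have h := hcross e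
    simp only [𝔾.stableLetter_eq_one he, mul_one] at h
    exact Germ.coe_eq.mpr h.symm
  let P : Subgroup (𝔾.FundamentalGroup T) :=
    { carrier := {z | ∀ v, (fun y => s v (y * z)) =ᶠ[cofinite] s v}
      mul_mem' := by
        intro z z' hz hz' v
        have h := ((hz' v).comp_tendsto (htend z)).trans (hz v)
        simpa only [Function.comp_def, mul_assoc] using h
      one_mem' := by intro v; simp only [mul_one]; exact EventuallyEq.rfl
      inv_mem' := by
        intro z hz v
        have h := ((hz v).comp_tendsto (htend z⁻¹)).symm
        simpa only [Function.comp_def, inv_mul_cancel_right] using h }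
  have hP : P = ⊤ := by
    refine 𝔾.subgroup_eq_top T (fun w x v => ?_) fun e v => ?_
    · have h := (hVW v w).comp_tendsto (htend (𝔾.vertexHom T w x))
      simp only [Function.comp_def, hsV] at h
      exact h.trans (hVW w v)
    · exact ((hVW v _).comp_tendsto (htend (𝔾.stableLetter T e))).trans
        ((hcross e).trans (hVW _ v))
  exact (hP ▸ Subgroup.mem_top z : z ∈ P) v

variable (T) in
/-- The vertices of the Bass–Serre tree. -/
def TreeVertex : Type := Σ v : 𝔾.V, 𝔾.FundamentalGroup T ⧸ (𝔾.vertexHom T v).range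

/-- The vertex of the Bass–Serre tree given by the coset of `g`. -/
def treeVertex (v : 𝔾.V) (g : 𝔾.FundamentalGroup T) : 𝔾.TreeVertex T :=
  ⟨v, (g : 𝔾.FundamentalGroup T ⧸ (𝔾.vertexHom T v).range)⟩

theorem exists_eq_treeVertex (p : 𝔾.TreeVertex T) : ∃ v g, p = 𝔾.treeVertex v g := by
  obtain ⟨v, x⟩ := p
  obtain ⟨g, rfl⟩ := QuotientGroup.mk_surjective x
  exact ⟨v, g, rfl⟩

theorem treeVertex_mul_vertexHom (v : 𝔾.V) (g : 𝔾.FundamentalGroup T) (x : 𝔾.Gv v) :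
    𝔾.treeVertex v (g * 𝔾.vertexHom T v x) = 𝔾.treeVertex v g := by
  refine congrArg (Sigma.mk v) (QuotientGroup.eq.mpr ⟨x⁻¹, ?_⟩)
  simp

theorem exists_eq_mul_vertexHom_of_treeVertex_eq {v w : 𝔾.V} {g h : 𝔾.FundamentalGroup T}
    (heq : 𝔾.treeVertex v g = 𝔾.treeVertex w h) : ∃ x : 𝔾.Gv w, g = h * 𝔾.vertexHom T w x := by
  obtain rfl : v = w := congrArg Sigma.fst heq
  obtain ⟨x, hx⟩ := QuotientGroup.eq.mp (eq_of_heq (Sigma.mk.inj heq).2).symm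
  exact ⟨x, by rw [hx]; simp⟩

/-- The initial vertex of the edge of the Bass–Serre tree given by an oriented edge and a group
element. -/
def treeIni (ε : 𝔾.E × 𝔾.FundamentalGroup T) : 𝔾.TreeVertex T :=
  𝔾.treeVertex (𝔾.ini ε.1) ε.2

/-- The terminal vertex of the edge of the Bass–Serre tree given by an oriented edge and a group
element. -/
def treeTer (ε : 𝔾.E × 𝔾.FundamentalGroup T) : 𝔾.TreeVertex T :=
  𝔾.treeVertex (𝔾.ini (𝔾.bar ε.1)) (ε.2 * 𝔾.stableLetter T ε.1)

theorem treeVertex_induction (hT : 𝔾.IsSpanningTree T) (P : 𝔾.TreeVertex T → Prop)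
    (hP : ∀ η, P (𝔾.treeIni η) ↔ P (𝔾.treeTer η)) (p q : 𝔾.TreeVertex T) (hp : P p) : P q := by
  have hVW : ∀ g v w, P (𝔾.treeVertex v g) ↔ P (𝔾.treeVertex w g) := by
    intro g v w
    refine iff_of_eq (𝔾.eq_of_forall_edge_eq hT (π := fun v => P (𝔾.treeVertex v g))
      (fun e he => propext ?_) v w)
    simpa [treeIni, treeTer, 𝔾.stableLetter_eq_one he] using hP (e, g)
  let Q : Subgroup (𝔾.FundamentalGroup T) :=
    { carrier := {x | ∀ g v, P (𝔾.treeVertex v (g * x)) ↔ P (𝔾.treeVertex v g)}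
      mul_mem' := by
        intro x y hx hy g v
        rw [← mul_assoc, hy, hx]
      one_mem' := by intro g v; rw [mul_one]
      inv_mem' := by
        intro x hx g v
        rw [← hx, inv_mul_cancel_right] }
  have hQ : Q = ⊤ := by
    refine 𝔾.subgroup_eq_top T (fun w x g v => ?_) fun e g v => ?_
    · rw [hVW _ v w, treeVertex_mul_vertexHom, hVW _ w v]
    · rw [hVW _ v (𝔾.ini (𝔾.bar e)), hVW g v (𝔾.ini e)]
      exact (hP (e, g)).symm
  obtain ⟨v, g, rfl⟩ := 𝔾.exists_eq_treeVertex p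
  obtain ⟨w, h, rfl⟩ := 𝔾.exists_eq_treeVertex q
  have h1 := (hQ ▸ Subgroup.mem_top (g⁻¹ * h) : g⁻¹ * h ∈ Q) g w
  rw [mul_inv_cancel_left] at h1
  rw [h1, hVW g w v]
  exact hp

theorem treeTer_eq_of_mem {a : 𝔾.E} {g h : 𝔾.FundamentalGroup T}
    (hm : g⁻¹ * h ∈ 𝔾.edgeSubgroup T a) : 𝔾.treeTer (a, g) = 𝔾.treeTer (a, h) := by
  obtain ⟨x, hx⟩ := hm
  obtain rfl : h = g * 𝔾.vertexHom T (𝔾.ini a) (𝔾.mono a x) := eq_mul_of_inv_mul_eq hx.symm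
  simp only [treeTer]
  rw [mul_assoc, vertexHom_mono_mul_stableLetter, ← mul_assoc, treeVertex_mul_vertexHom]

theorem treeIni_eq_of_mem {a : 𝔾.E} {g h : 𝔾.FundamentalGroup T}
    (hm : g⁻¹ * h ∈ 𝔾.edgeSubgroup T a) : 𝔾.treeIni (a, g) = 𝔾.treeIni (a, h) := by
  obtain ⟨x, hx⟩ := hm
  obtain rfl : h = g * 𝔾.vertexHom T (𝔾.ini a) (𝔾.mono a x) := eq_mul_of_inv_mul_eq hx.symm
  simp only [treeIni]
  rw [treeVertex_mul_vertexHom]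

theorem treeIni_bar (e : 𝔾.E) (g : 𝔾.FundamentalGroup T) :
    𝔾.treeIni (𝔾.bar e, g * 𝔾.stableLetter T e) = 𝔾.treeTer (e, g) := rfl

theorem treeTer_bar (e : 𝔾.E) (g : 𝔾.FundamentalGroup T) :
    𝔾.treeTer (𝔾.bar e, g * 𝔾.stableLetter T e) = 𝔾.treeIni (e, g) := by
  simp [treeIni, treeTer, 𝔾.bar_invol, stableLetter_bar]

theorem treeEnds_of_crossing {ε η : 𝔾.E × 𝔾.FundamentalGroup T}
    (h : 𝔾.crossing T ε.1 η.1 (ε.2⁻¹ * η.2) ≠ 0) :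
    (𝔾.treeIni ε = 𝔾.treeIni η ∧ 𝔾.treeTer ε = 𝔾.treeTer η) ∨
      (𝔾.treeIni ε = 𝔾.treeTer η ∧ 𝔾.treeTer ε = 𝔾.treeIni η) := by
  obtain ⟨a, g⟩ := ε
  obtain ⟨e, g'⟩ := η
  rcases 𝔾.crossing_ne_zero_iff.mp h with ⟨rfl, hm⟩ | ⟨he, hm⟩
  · exact Or.inl ⟨𝔾.treeIni_eq_of_mem hm, 𝔾.treeTer_eq_of_mem hm⟩
  · right
    obtain rfl : a = 𝔾.bar e := (𝔾.bar_eq_iff.mpr he).symm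
    rw [mul_assoc] at hm
    exact ⟨(𝔾.treeIni_eq_of_mem hm).trans (𝔾.treeIni_bar e g'),
      (𝔾.treeTer_eq_of_mem hm).trans (𝔾.treeTer_bar e g')⟩

end GraphOfGroups

section AlmostInvariant

open Filter

variable {Γ : Type*} [Group Γ] {U : Set Γ} {χ : Γ → ZMod 2}

/-- The coboundary of an almost invariant set is finite. -/
theorem exists_wordDist_bound_of_ne (hUfin : U.Finite) (hU : Subgroup.closure U = ⊤)
    (hχ : ∀ z, (fun y => χ (y * z)) =ᶠ[cofinite] χ) (r : ℕ) :
    ∃ ρ : ℕ, ∀ y y', wordDist U y y' ≤ r → χ y ≠ χ y' → wordDist U 1 y ≤ ρ := by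
  have hfin : (⋃ z ∈ {z | wordDist U 1 z ≤ r}, {y | χ (y * z) ≠ χ y}).Finite :=
    (finite_wordDist_ball hUfin hU 1 r).biUnion fun z _ => hχ z
  obtain ⟨ρ, hρ⟩ := exists_wordDist_bound hfin U 1
  refine ⟨ρ, fun y y' hd hne => hρ y ?_⟩
  refine Set.mem_iUnion₂.mpr ⟨y⁻¹ * y', ?_, ?_⟩
  · rwa [Set.mem_ofPred_eq, wordDist_one_inv_mul]
  · rw [Set.mem_ofPred_eq, mul_inv_cancel_left]
    exact hne.symm

/-- A quasi-isometrically embedded one-ended group essentially lies on one side of any translate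
of an almost invariant set. -/
theorem exists_side_near_of_oneEnded {H : Type} [Group H] (hH : OneEnded H) (S : Finset H)
    (hS : Subgroup.closure (S : Set H) = ⊤) (hUfin : U.Finite) (hU : Subgroup.closure U = ⊤)
    (hχ : ∀ z, (fun y => χ (y * z)) =ᶠ[cofinite] χ) {K : ℝ} (hK : 0 < K) (C : ℝ) :
    ∃ R : ℝ, ∀ f : H → Γ,
      IsQIEmbedding K C (fun a b => (wordDist (S : Set H) a b : ℝ))
        (fun a b => (wordDist U a b : ℝ)) f →
      ∀ g : Γ, ∃ b : ZMod 2, ∀ h : H, χ (g⁻¹ * f h) = b → (wordDist U g (f h) : ℝ) ≤ R := by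
  obtain ⟨ρ, hρ⟩ := exists_wordDist_bound_of_ne hUfin hU hχ ⌈K + C⌉₊
  obtain ⟨D, hD⟩ := hH.exists_ball_of_boundary_subset_ball S hS ⌈K * (2 * ρ + C)⌉₊
  refine ⟨K * D + C + ρ, fun f hf g => ?_⟩
  have hnear : ∀ x y, (cayleyGraph (S : Set H)).Adj x y → χ (g⁻¹ * f x) ≠ χ (g⁻¹ * f y) →
      wordDist U g (f x) ≤ ρ := by
    intro x y hadj hne
    rw [← wordDist_one_inv_mul]
    refine hρ _ _ ?_ hne
    rw [wordDist_mul_left]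
    have h1 : (wordDist (S : Set H) x y : ℝ) ≤ 1 := mod_cast wordDist_le_one_of_adj hadj
    have h2 := (hf x y).2
    have h3 : (wordDist U (f x) (f y) : ℝ) ≤ ⌈K + C⌉₊ := by
      refine le_trans ?_ (Nat.le_ceil _)
      nlinarith
    exact_mod_cast h3
  have hclose : ∀ x y, wordDist U g (f x) ≤ ρ → wordDist U g (f y) ≤ ρ →
      wordDist (S : Set H) x y ≤ ⌈K * (2 * ρ + C)⌉₊ := by
    intro x y hx hy
    have h1 := (hf x y).1
    have h2 : wordDist U (f x) (f y) ≤ ρ + ρ := by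
      refine (wordDist_triangle hU (f x) g (f y)).trans (add_le_add ?_ hy)
      rwa [wordDist_comm]
    have h3 : (wordDist U (f x) (f y) : ℝ) ≤ ρ + ρ := mod_cast h2
    have h4 : 1 / K * (wordDist (S : Set H) x y : ℝ) ≤ 2 * ρ + C := by
      have := h1
      simp only at this
      linarith
    have h5 : (wordDist (S : Set H) x y : ℝ) ≤ K * (2 * ρ + C) := by
      rw [one_div, inv_mul_le_iff₀ hK] at h4
      exact h4
    exact_mod_cast h5.trans (Nat.le_ceil _)
  let A : Set H := {h | χ (g⁻¹ * f h) = 0}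
  by_cases hbd : ∃ x y, (cayleyGraph (S : Set H)).Adj x y ∧ x ∈ A ∧ y ∉ A
  · obtain ⟨c, c', hadj, hc, hc'⟩ := hbd
    have hcρ : wordDist U g (f c) ≤ ρ := hnear c c' hadj fun h => hc' (h.symm.trans hc)
    have hfar : ∀ h, wordDist (S : Set H) c h ≤ D →
        (wordDist U g (f h) : ℝ) ≤ K * D + C + ρ := by
      intro h hh
      have h1 := (hf c h).2
      have h2 : (wordDist U g (f h) : ℝ) ≤ wordDist U g (f c) + wordDist U (f c) (f h) :=
        mod_cast wordDist_triangle hU g (f c) (f h)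
      have h3 : (wordDist (S : Set H) c h : ℝ) ≤ D := mod_cast hh
      have h4 : (wordDist U g (f c) : ℝ) ≤ ρ := mod_cast hcρ
      have h5 := mul_le_mul_of_nonneg_left h3 hK.le
      simp only at h1
      linarith
    rcases hD A c fun x y hxy hx hy => by
      have hne : χ (g⁻¹ * f x) ≠ χ (g⁻¹ * f y) := fun h => hy (h.symm.trans hx)
      exact ⟨hclose c x hcρ (hnear x y hxy hne), hclose c y hcρ (hnear y x hxy.symm hne.symm)⟩
      with h | h
    · exact ⟨0, fun x hx => hfar x (h x hx)⟩
    · exact ⟨1, fun x hx => hfar x (h x fun hx' => zero_ne_one (hx'.symm.trans hx))⟩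
  · have hall : ∀ x y, x ∈ A → y ∈ A := by
      intro x y hx
      by_contra hy
      obtain ⟨p⟩ := cayleyGraph_preconnected hS x y
      obtain ⟨d, -, h1, h2⟩ := p.exists_boundary_dart A hx hy
      exact hbd ⟨d.fst, d.snd, d.adj, h1, h2⟩
    by_cases h1 : (1 : H) ∈ A
    · exact ⟨1, fun x hx => absurd ((hall 1 x h1).symm.trans hx) zero_ne_one⟩
    · exact ⟨0, fun x hx => absurd (hall x 1 hx) h1⟩

end AlmostInvariant

namespace GraphOfGroups

variable (𝔾 : GraphOfGroups) {T : Set 𝔾.E}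

/-- The side of the translate `g` of the edge `a` containing a vertex of the Bass–Serre tree. -/
noncomputable def treeSide (s : 𝔾.E → 𝔾.V → 𝔾.FundamentalGroup T → ZMod 2)
    (ε : 𝔾.E × 𝔾.FundamentalGroup T) (p : 𝔾.TreeVertex T) : ZMod 2 :=
  s ε.1 p.1 (ε.2⁻¹ * p.2.out)

theorem treeSide_treeVertex {s : 𝔾.E → 𝔾.V → 𝔾.FundamentalGroup T → ZMod 2}
    (hsV : ∀ a v g x, s a v (g * 𝔾.vertexHom T v x) = s a v g)
    (ε : 𝔾.E × 𝔾.FundamentalGroup T) (v : 𝔾.V) (g : 𝔾.FundamentalGroup T) :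
    𝔾.treeSide s ε (𝔾.treeVertex v g) = s ε.1 v (ε.2⁻¹ * g) := by
  obtain ⟨⟨_, x, rfl⟩, hx⟩ := QuotientGroup.mk_out_eq_mul (𝔾.vertexHom T v).range g
  have h := hsV ε.1 v (ε.2⁻¹ * g) x
  rw [mul_assoc] at h
  exact (congrArg (fun y => s ε.1 v (ε.2⁻¹ * y)) hx).trans h

theorem treeSide_ne_iff {s : 𝔾.E → 𝔾.V → 𝔾.FundamentalGroup T → ZMod 2}
    (hsV : ∀ a v g x, s a v (g * 𝔾.vertexHom T v x) = s a v g)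
    (hsE : ∀ a e g, s a (𝔾.ini (𝔾.bar e)) (g * 𝔾.stableLetter T e) =
      s a (𝔾.ini e) g + 𝔾.crossing T a e g) (ε η : 𝔾.E × 𝔾.FundamentalGroup T) :
    𝔾.treeSide s ε (𝔾.treeIni η) ≠ 𝔾.treeSide s ε (𝔾.treeTer η) ↔
      𝔾.crossing T ε.1 η.1 (ε.2⁻¹ * η.2) ≠ 0 := by
  rw [treeIni, treeTer, 𝔾.treeSide_treeVertex hsV, 𝔾.treeSide_treeVertex hsV, ← mul_assoc, hsE,
    ne_eq, ne_eq, left_eq_add]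

theorem finite_setOf_crossing_ne_zero (hfin : 𝔾.FiniteEdgeGroups)
    (η : 𝔾.E × 𝔾.FundamentalGroup T) :
    {ε : 𝔾.E × 𝔾.FundamentalGroup T | 𝔾.crossing T ε.1 η.1 (ε.2⁻¹ * η.2) ≠ 0}.Finite := by
  have := 𝔾.fE
  have h : ∀ a, {g | 𝔾.crossing T a η.1 (g⁻¹ * η.2) ≠ 0}.Finite := fun a =>
    Set.Finite.preimage (((mul_left_injective η.2).comp inv_injective).injOn)
      (𝔾.crossing_eventuallyEq_zero (T := T) hfin a η.1)
  refine (Set.finite_iUnion fun a => (h a).image (Prod.mk a)).subset fun ε hε => ?_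
  exact Set.mem_iUnion.mpr ⟨ε.1, ε.2, hε, rfl⟩

/-- The image of a quasi-isometric embedding of a one-ended group in the fundamental group of a
graph of groups with finite edge groups is near a vertex space. -/
theorem exists_vertex_space_near (hT : 𝔾.IsSpanningTree T) (hfin : 𝔾.FiniteEdgeGroups)
    {H : Type} [Group H] (hH : OneEnded H) (S : Finset H)
    (hS : Subgroup.closure (S : Set H) = ⊤) {U : Set (𝔾.FundamentalGroup T)} (hUfin : U.Finite)
    (hU : Subgroup.closure U = ⊤) {K : ℝ} (hK : 0 < K) (C : ℝ) :
    ∃ R : ℝ, ∀ f : H → 𝔾.FundamentalGroup T,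
      IsQIEmbedding K C (fun a b => (wordDist (S : Set H) a b : ℝ))
        (fun a b => (wordDist U a b : ℝ)) f →
      ∃ (v : 𝔾.V) (g : 𝔾.FundamentalGroup T), ∀ h : H, ∃ x : 𝔾.Gv v,
        (wordDist U (f h) (g * 𝔾.vertexHom T v x) : ℝ) ≤ R := by
  have := 𝔾.fE
  choose s hsV hsE using 𝔾.exists_side hT
  obtain ⟨v₀⟩ := 𝔾.conn.nonempty
  choose R₁ hR₁ using fun a => exists_side_near_of_oneEnded hH S hS hUfin hU
    (𝔾.side_mul_eventuallyEq hT hfin (hsV a) (hsE a) v₀) hK C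
  obtain ⟨R₂, hR₂⟩ := (Set.finite_range R₁).bddAbove
  obtain ⟨M, hM⟩ := exists_wordDist_bound (Set.finite_range (𝔾.stableLetter T)) U 1
  refine ⟨max R₂ 0 + M, fun f hf => ?_⟩
  choose b hb using fun ε : 𝔾.E × 𝔾.FundamentalGroup T => hR₁ ε.1 f hf ε.2
  have hb' : ∀ ε h, 𝔾.treeSide s ε (𝔾.treeVertex v₀ (f h)) = b ε →
      (wordDist U (f h) ε.2 : ℝ) ≤ max R₂ 0 := by
    intro ε h hε
    rw [𝔾.treeSide_treeVertex hsV] at hε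
    rw [wordDist_comm]
    exact ((hb ε h hε).trans (hR₂ ⟨ε.1, rfl⟩)).trans (le_max_left _ _)
  have hne := 𝔾.treeSide_ne_iff hsV hsE
  obtain ⟨p, hp⟩ := exists_vertex_forall_distinguished_side (σ := 𝔾.treeSide s)
    (ini := 𝔾.treeIni) (ter := 𝔾.treeTer)
    (fun ε η h => 𝔾.treeEnds_of_crossing ((hne ε η).mp h))
    (𝔾.treeVertex_induction hT)
    (fun η => (hne η η).mpr (𝔾.crossing_ne_zero_iff.mpr (Or.inl ⟨rfl, by
      rw [inv_mul_cancel]; exact Subgroup.one_mem _⟩)))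
    (fun η => (𝔾.finite_setOf_crossing_ne_zero hfin η).subset fun ε h => (hne ε η).mp h)
    b (𝔾.treeVertex v₀ (f 1))
    ((Set.finite_univ.prod (finite_wordDist_ball hUfin hU (f 1) ⌊max R₂ 0⌋₊)).subset
      fun ε hε => ⟨trivial, Nat.le_floor (hb' ε 1 hε)⟩)
  obtain ⟨v, g, rfl⟩ := 𝔾.exists_eq_treeVertex p
  refine ⟨v, g, fun h => ?_⟩
  have hM0 : (0 : ℝ) ≤ M := Nat.cast_nonneg M
  rcases hp (𝔾.treeVertex v₀ (f h)) with hq | ⟨⟨a, g₀⟩, hq, hε⟩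
  · obtain ⟨x, hx⟩ := 𝔾.exists_eq_mul_vertexHom_of_treeVertex_eq hq
    refine ⟨x, ?_⟩
    rw [← hx, wordDist_self, Nat.cast_zero]
    exact add_nonneg (le_max_right _ _) hM0
  · have hd := hb' _ h hε
    rcases hq with hq | hq
    · obtain ⟨x, hx⟩ := 𝔾.exists_eq_mul_vertexHom_of_treeVertex_eq hq
      refine ⟨x, ?_⟩
      rw [← hx]
      exact hd.trans (le_add_of_nonneg_right hM0)
    · obtain ⟨x, hx⟩ := 𝔾.exists_eq_mul_vertexHom_of_treeVertex_eq hq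
      refine ⟨x, ?_⟩
      rw [← hx]
      have h1 : (wordDist U (f h) (g₀ * 𝔾.stableLetter T a) : ℝ) ≤
          wordDist U (f h) g₀ + wordDist U g₀ (g₀ * 𝔾.stableLetter T a) :=
        mod_cast wordDist_triangle hU _ _ _
      have h2 : (wordDist U g₀ (g₀ * 𝔾.stableLetter T a) : ℝ) ≤ M := by
        rw [← wordDist_one_inv_mul, inv_mul_cancel_left]
        exact mod_cast hM _ ⟨a, rfl⟩
      exact h1.trans (add_le_add hd h2)

end GraphOfGroups

/-- **Lemma.** Let `G` be the fundamental group of a terminal graph of groups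
`𝔾` (the vertex spaces of the tree-of-spaces model for `G` being the left
cosets of the images of the vertex groups), and let `H` be a one-ended
finitely generated group.  For any constants `(K, C)` there is an `R`,
depending only on `(K, C)`, `G` and `H` (with fixed word metrics), such that
for every `(K, C)`-quasi-isometric embedding `f : H → G` there is a vertex
space of `G` whose `R`-neighborhood contains `f(H)`. -/
theorem qi_embedding_of_one_ended_near_vertex_space
    (G : Type) [Group G] [Group.FG G]
    (𝔾 : GraphOfGroups) (T : Set 𝔾.E) (hT : 𝔾.IsSpanningTree T)
    (hterm : 𝔾.Terminal) (iso : G ≃* 𝔾.FundamentalGroup T)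
    (H : Type) [Group H] [Group.FG H] (hH : OneEnded H)
    (S : Finset H) (hS : Subgroup.closure (S : Set H) = ⊤)
    (U : Finset G) (hU : Subgroup.closure (U : Set G) = ⊤)
    (K C : ℝ) :
    ∃ R : ℝ, ∀ f : H → G,
      IsQIEmbedding K C (fun a b => (wordDist (S : Set H) a b : ℝ))
        (fun a b => (wordDist (U : Set G) a b : ℝ)) f →
      ∃ (v : 𝔾.V) (g : 𝔾.FundamentalGroup T), ∀ h : H, ∃ x : 𝔾.Gv v,
        (wordDist (U : Set G) (f h) (iso.symm (g * 𝔾.vertexHom T v x)) : ℝ) ≤ R := by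
  rcases le_or_gt K 0 with hK | hK
  · obtain ⟨v⟩ := 𝔾.conn.nonempty
    refine ⟨C, fun f hf => ⟨v, iso (f 1), fun h => ⟨1, ?_⟩⟩⟩
    rw [map_one, mul_one, MulEquiv.symm_apply_apply]
    have hd := (hf h 1).2
    have h0 : K * (wordDist (S : Set H) h 1 : ℝ) ≤ 0 :=
      mul_nonpos_of_nonpos_of_nonneg hK (Nat.cast_nonneg _)
    simp only at hd
    linarith
  · have hgen : Subgroup.closure (iso '' (U : Set G)) = ⊤ := by
      have h := MonoidHom.map_closure iso.toMonoidHom (U : Set G)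
      rw [hU, Subgroup.map_top_of_surjective _ iso.surjective] at h
      exact h.symm
    obtain ⟨R, hR⟩ := 𝔾.exists_vertex_space_near hT hterm.1 hH S hS
      (U.finite_toSet.image iso) hgen hK C
    refine ⟨R, fun f hf => ?_⟩
    obtain ⟨v, g, hvg⟩ := hR (iso ∘ f) fun a b => by
      simpa only [Function.comp_apply, wordDist_map] using hf a b
    refine ⟨v, g, fun h => ?_⟩
    obtain ⟨x, hx⟩ := hvg h
    refine ⟨x, ?_⟩
    rwa [← wordDist_map iso, MulEquiv.apply_symm_apply]
end

section
/- Let G be any finitely generated group of order at least three. Then the groups G*G, G*ℤ, G*G*G and G*(ℤ/2ℤ) are all quasi-isometric to one another. -/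
/-- `x` and `y` are joined by an undirected path of length at most `n` along `E`. -/
def Near {X : Type*} (E : X → X → Prop) : ℕ → X → X → Prop
  | 0 => Eq
  | n + 1 => fun x z => ∃ y, Near E n x y ∧ (y = z ∨ E y z ∨ E z y)

namespace Near

variable {X Y : Type*} {E : X → X → Prop} {E' : Y → Y → Prop}

theorem succ {n : ℕ} {x y : X} (h : Near E n x y) : Near E (n + 1) x y := ⟨y, h, Or.inl rfl⟩

theorem mono {n m : ℕ} (hnm : n ≤ m) {x y : X} (h : Near E n x y) : Near E m x y := by
  induction hnm with
  | refl => exact h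
  | step _ ih => exact ih.succ

theorem refl (n : ℕ) (x : X) : Near E n x x :=
  mono (Nat.zero_le n) (rfl : Near E 0 x x)

theorem of_eq (n : ℕ) {x y : X} (h : x = y) : Near E n x y := h ▸ refl n x

theorem edge {x y : X} (h : E x y) : Near E 1 x y := ⟨x, rfl, Or.inr (Or.inl h)⟩

theorem trans {n m : ℕ} {x y z : X} (h : Near E n x y) (h' : Near E m y z) :
    Near E (n + m) x z := by
  induction m generalizing z with
  | zero => obtain rfl : y = z := h'; exact h
  | succ m ih =>
    obtain ⟨w, hw, hz⟩ := h'
    exact ⟨w, ih hw, hz⟩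

theorem symm {n : ℕ} {x y : X} (h : Near E n x y) : Near E n y x := by
  induction n generalizing y with
  | zero => exact Eq.symm h
  | succ n ih =>
    obtain ⟨w, hw, hz⟩ := h
    have h1 : Near E 1 y w :=
      ⟨y, rfl, hz.elim (fun h => Or.inl h.symm) (fun h => Or.inr h.symm)⟩
    exact mono (by omega) (h1.trans (ih hw))

theorem map {f : X → Y} {K : ℕ} (hf : ∀ x x', E x x' → Near E' K (f x) (f x')) {n : ℕ}
    {x y : X} (h : Near E n x y) : Near E' (K * n) (f x) (f y) := by
  induction n generalizing y with
  | zero => exact of_eq _ (congrArg f h)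
  | succ n ih =>
    obtain ⟨w, hw, hz⟩ := h
    refine (ih hw).trans ?_
    rcases hz with rfl | hz | hz
    · exact refl _ _
    · exact hf _ _ hz
    · exact (hf _ _ hz).symm

end Near

/-- The graphs `E` and `E'` admit mutually coarsely inverse Lipschitz maps. -/
def CoarselyEquivalent {X Y : Type*} (E : X → X → Prop) (E' : Y → Y → Prop) : Prop :=
  ∃ (K : ℕ) (f : X → Y) (g : Y → X), (∀ x x', E x x' → Near E' K (f x) (f x')) ∧
    (∀ y y', E' y y' → Near E K (g y) (g y')) ∧
    (∀ x, Near E K x (g (f x))) ∧ ∀ y, Near E' K y (f (g y))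

namespace CoarselyEquivalent

variable {X Y Z : Type*} {E : X → X → Prop} {E' : Y → Y → Prop} {E'' : Z → Z → Prop}

theorem symm (h : CoarselyEquivalent E E') : CoarselyEquivalent E' E := by
  obtain ⟨K, f, g, h1, h2, h3, h4⟩ := h
  exact ⟨K, g, f, h2, h1, h4, h3⟩

theorem trans (h : CoarselyEquivalent E E') (h' : CoarselyEquivalent E' E'') :
    CoarselyEquivalent E E'' := by
  obtain ⟨K, f, g, h1, h2, h3, h4⟩ := h
  obtain ⟨L, f', g', h1', h2', h3', h4'⟩ := h'
  refine ⟨K * L + K + L, f' ∘ f, g ∘ g', fun x x' hx => ?_, fun z z' hz => ?_, fun x => ?_,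
    fun z => ?_⟩
  · exact (Near.map h1' (h1 _ _ hx)).mono (by nlinarith)
  · exact (Near.map h2 (h2' _ _ hz)).mono (by nlinarith)
  · exact ((h3 x).trans (Near.map h2 (h3' (f x)))).mono (by nlinarith)
  · exact ((h4' z).trans (Near.map h1' (h4 (g' z)))).mono (by nlinarith)

end CoarselyEquivalent

/-- The Cayley graph of a group with respect to `S`. -/
def CayleyAdj {Γ : Type*} [Group Γ] (S : Set Γ) (x y : Γ) : Prop := ∃ s ∈ S, y = x * s

section Cayley

variable {Γ Γ' : Type*} [Group Γ] [Group Γ'] {S : Set Γ} {T : Set Γ'}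

theorem exists_list_prod_eq (hS : Subgroup.closure S = ⊤) (z : Γ) :
    ∃ l : List Γ, (∀ x ∈ l, x ∈ S ∨ x⁻¹ ∈ S) ∧ l.prod = z := by
  have hz : z ∈ (Subgroup.closure S).toSubmonoid := by rw [hS]; trivial
  rw [Subgroup.closure_toSubmonoid] at hz
  simpa using Submonoid.exists_list_of_mem_closure hz

theorem Near.wordDist_le {n : ℕ} {x y : Γ} (h : Near (CayleyAdj S) n x y) :
    wordDist S x y ≤ n := by
  obtain ⟨l, hl, hS, hp⟩ : ∃ l : List Γ, l.length ≤ n ∧ (∀ x ∈ l, x ∈ S ∨ x⁻¹ ∈ S) ∧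
      l.prod = x⁻¹ * y := by
    induction n generalizing y with
    | zero =>
      obtain rfl : x = y := h
      exact ⟨[], by simp⟩
    | succ n ih =>
      obtain ⟨w, hw, hz⟩ := h
      obtain ⟨l, hl, hS, hp⟩ := ih hw
      rcases hz with rfl | ⟨s, hs, rfl⟩ | ⟨s, hs, rfl⟩
      · exact ⟨l, by omega, hS, hp⟩
      · refine ⟨l ++ [s], by simpa using hl, ?_, by simp [hp, mul_assoc]⟩
        simp only [List.mem_append, List.mem_singleton]
        rintro z (hz | rfl)
        exacts [hS z hz, Or.inl hs]
      · refine ⟨l ++ [s⁻¹], by simpa using hl, ?_, by simp [hp, mul_assoc]⟩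
        simp only [List.mem_append, List.mem_singleton]
        rintro z (hz | rfl)
        exacts [hS z hz, Or.inr (by simpa using hs)]
  refine le_trans (Nat.sInf_le ?_) hl
  exact ⟨l, rfl, hS, hp⟩

theorem near_mul_list_prod (x : Γ) (l : List Γ) (hl : ∀ z ∈ l, z ∈ S ∨ z⁻¹ ∈ S) :
    Near (CayleyAdj S) l.length x (x * l.prod) := by
  induction l generalizing x with
  | nil => exact Near.of_eq _ (by simp)
  | cons s l ih =>
    have h1 : Near (CayleyAdj S) 1 x (x * s) := by
      rcases hl s (by simp) with hs | hs
      · have h2 : CayleyAdj S x (x * s) := ⟨s, hs, rfl⟩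
        exact Near.edge h2
      · have h2 : CayleyAdj S (x * s) x := ⟨s⁻¹, hs, by simp⟩
        exact (Near.edge h2).symm
    have h2 := h1.trans (ih (x * s) fun z hz => hl z (List.mem_cons_of_mem _ hz))
    rw [List.prod_cons, ← mul_assoc, List.length_cons]
    exact h2.mono (by omega)

theorem near_wordDist (hS : Subgroup.closure S = ⊤) (x y : Γ) :
    Near (CayleyAdj S) (wordDist S x y) x y := by
  have hne : {n | ∃ l : List Γ, l.length = n ∧ (∀ x ∈ l, x ∈ S ∨ x⁻¹ ∈ S) ∧
      l.prod = x⁻¹ * y}.Nonempty := by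
    obtain ⟨l, hl, hp⟩ := exists_list_prod_eq hS (x⁻¹ * y)
    exact ⟨_, l, rfl, hl, hp⟩
  obtain ⟨l, hl, hS', hp⟩ := Nat.sInf_mem hne
  have := near_mul_list_prod x l hS'
  rw [hl, hp, mul_inv_cancel_left] at this
  exact this

theorem exists_near_mul (hS : Subgroup.closure S = ⊤) (z : Γ) :
    ∃ n, ∀ x, Near (CayleyAdj S) n x (x * z) := by
  obtain ⟨l, hl, hp⟩ := exists_list_prod_eq hS z
  exact ⟨l.length, fun x => hp ▸ near_mul_list_prod x l hl⟩

theorem exists_near_mul_of_finite (hS : Subgroup.closure S = ⊤) {F : Set Γ} (hF : F.Finite) :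
    ∃ n, ∀ z ∈ F, ∀ x, Near (CayleyAdj S) n x (x * z) := by
  choose n hn using exists_near_mul hS
  obtain ⟨b, hb⟩ := (hF.image n).bddAbove
  exact ⟨b, fun z hz x => (hn z x).mono (hb ⟨z, hz, rfl⟩)⟩

theorem CoarselyEquivalent.quasiIsometricGroups (hSf : S.Finite) (hTf : T.Finite)
    (hS : Subgroup.closure S = ⊤) (hT : Subgroup.closure T = ⊤)
    (h : CoarselyEquivalent (CayleyAdj S) (CayleyAdj T)) : QuasiIsometricGroups Γ Γ' := by
  lift S to Finset Γ using hSf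
  lift T to Finset Γ' using hTf
  obtain ⟨K, f, g, hf, hg, hgf, hfg⟩ := h
  refine ⟨S, T, hS, hT, K + 1, 2 * K, f, by positivity, by positivity, fun a b => ⟨?_, ?_⟩,
    fun y => ⟨g y, ?_⟩⟩
  · have h1 := (((hgf a).trans (Near.map hg (near_wordDist hT (f a) (f b)))).trans
      (hgf b).symm).wordDist_le
    have h2 : (wordDist (S : Set Γ) a b : ℝ) ≤
        K + K * wordDist (T : Set Γ') (f a) (f b) + K := by exact_mod_cast h1
    have h3 : (0 : ℝ) ≤ wordDist (T : Set Γ') (f a) (f b) := by positivity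
    have h4 : (0 : ℝ) ≤ K := by positivity
    rw [sub_le_iff_le_add, one_div, inv_mul_le_iff₀ (by positivity)]
    nlinarith
  · have h1 := (Near.map hf (near_wordDist hS a b)).wordDist_le
    have h2 : (wordDist (T : Set Γ') (f a) (f b) : ℝ) ≤
        K * wordDist (S : Set Γ) a b := by exact_mod_cast h1
    have h3 : (0 : ℝ) ≤ wordDist (S : Set Γ) a b := by positivity
    have h4 : (0 : ℝ) ≤ K := by positivity
    nlinarith
  · have h1 := (hfg y).symm.wordDist_le
    have h2 : (wordDist (T : Set Γ') (f (g y)) y : ℝ) ≤ K := by exact_mod_cast h1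
    have h4 : (0 : ℝ) ≤ K := by positivity
    linarith

/-- A group acting on a graph is coarsely equivalent to it as soon as generators move points a
bounded distance and the orbit map has an equivariant Lipschitz inverse `r`. -/
theorem CoarselyEquivalent.of_action {X : Type*} {E : X → X → Prop} (α : Γ →* Equiv.Perm X)
    (x₀ : X) (r : X → Γ) (hS : Subgroup.closure S = ⊤) {K : ℕ}
    (hα : ∀ s ∈ S, ∀ y, Near E K y (α s y)) (hr : ∀ s ∈ S, ∀ y, r (α s y) = r y * s⁻¹)
    (hrE : ∀ y y', E y y' → Near (CayleyAdj S) K (r y) (r y')) (hr₀ : r x₀ = 1)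
    (hinv : ∀ y, α (r y)⁻¹ x₀ = y) : CoarselyEquivalent (CayleyAdj S) E := by
  have hr' : ∀ x y, r (α x y) = r y * x⁻¹ := by
    intro x
    have hx : x ∈ Subgroup.closure S := by rw [hS]; trivial
    induction hx using Subgroup.closure_induction with
    | mem s hs => exact hr s hs
    | one => simp
    | mul a b _ _ ha hb => intro y; rw [map_mul, Equiv.Perm.mul_apply, ha, hb]; group
    | inv a _ ha =>
      intro y
      have := ha (α a⁻¹ y)
      rw [← Equiv.Perm.mul_apply, ← map_mul] at this
      simp only [mul_inv_cancel, map_one, Equiv.Perm.one_apply] at this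
      rw [this]; group
  refine ⟨K, fun x => α x⁻¹ x₀, r, ?_, hrE, fun x => Near.of_eq _ ?_, fun y =>
    Near.of_eq _ (hinv y).symm⟩
  · rintro x _ ⟨s, hs, rfl⟩
    have := hα s hs (α (x * s)⁻¹ x₀)
    rw [← Equiv.Perm.mul_apply, ← map_mul] at this
    simpa using this.symm
  · rw [hr', hr₀]; simp

end Cayley

section Decode

variable {A N : Type*} [DecidableEq A] (p : A) (root : N) (succ : N → Option N)
  (child : N → A → N)

/-- The node reached from `n` by reading the slot `a`: the letter `p` passes to the successor
of `n` if there is one, and every other letter passes to a child of `n`. -/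
def readSlot (n : N) (a : A) : N :=
  match succ n with
  | some k => if a = p then k else child n a
  | none => child n a

/-- The node addressed by a word of slots, the most recent slot standing first. -/
def decode : List A → N
  | [] => root
  | a :: s => readSlot p succ child (decode s) a

variable {p root succ child}

theorem readSlot_of_succ {n k : N} (h : succ n = some k) : readSlot p succ child n p = k := by
  simp [readSlot, h]

theorem readSlot_of_valid {n : N} {a : A} (h : succ n = none ∨ a ≠ p) :
    readSlot p succ child n a = child n a := by
  unfold readSlot
  split
  · rename_i k hk
    rcases h with h | h
    · simp [h] at hk
    · simp [h]
  · rfl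

theorem readSlot_cases (n : N) (a : A) :
    (∃ k, succ n = some k ∧ a = p) ∨ (succ n = none ∨ a ≠ p) := by
  by_cases ha : a = p
  · cases h : succ n with
    | none => simp
    | some k => exact Or.inl ⟨k, rfl, ha⟩
  · exact Or.inr (Or.inr ha)

theorem decode_bijective (rank : N → ℕ)
    (child_inj : ∀ n a n' a', child n a = child n' a' → n = n' ∧ a = a')
    (child_ne : ∀ n a, child n a ≠ root) (succ_ne : ∀ n, succ n ≠ some root)
    (succ_inj : ∀ n n' k, succ n = some k → succ n' = some k → n = n')
    (disj : ∀ n n' a, succ n = some (child n' a) → ¬(succ n' = none ∨ a ≠ p))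
    (cover : ∀ n, n = root ∨
      (∃ n' a, (succ n' = none ∨ a ≠ p) ∧ child n' a = n ∧ rank n' < rank n) ∨
      ∃ n', succ n' = some n ∧ rank n' < rank n) :
    Function.Bijective (decode p root succ child) := by
  have hne : ∀ n a, readSlot p succ child n a ≠ root := by
    intro n a
    rcases readSlot_cases (p := p) (succ := succ) n a with ⟨k, hk, rfl⟩ | h
    · rw [readSlot_of_succ hk]
      rintro rfl
      exact succ_ne n hk
    · rw [readSlot_of_valid h]
      exact child_ne n a
  have hinj : ∀ n a n' a', readSlot p succ child n a = readSlot p succ child n' a' →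
      n = n' ∧ a = a' := by
    intro n a n' a' h
    have key := readSlot_cases (p := p) (succ := succ)
    rcases key n a with ⟨k, hk, rfl⟩ | hv <;> rcases key n' a' with ⟨k', hk', rfl⟩ | hv'
    · rw [readSlot_of_succ hk, readSlot_of_succ hk'] at h
      exact ⟨succ_inj n n' k hk (h ▸ hk'), rfl⟩
    · rw [readSlot_of_succ hk, readSlot_of_valid hv'] at h
      exact absurd hv' (disj n n' a' (h ▸ hk))
    · rw [readSlot_of_succ hk', readSlot_of_valid hv] at h
      exact absurd hv (disj n' n a (h ▸ hk'))
    · rw [readSlot_of_valid hv, readSlot_of_valid hv'] at h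
      exact child_inj n a n' a' h
  constructor
  · intro s
    induction s with
    | nil =>
      rintro (_ | ⟨a, s⟩) h
      · rfl
      · exact absurd h.symm (hne _ _)
    | cons a s ih =>
      rintro (_ | ⟨a', s'⟩) h
      · exact absurd h (hne _ _)
      · obtain ⟨h1, rfl⟩ := hinj _ _ _ _ h
        rw [ih h1]
  · intro n
    induction hr : rank n using Nat.strong_induction_on generalizing n with
    | _ r ih =>
      subst hr
      rcases cover n with rfl | ⟨n', a, hv, rfl, hlt⟩ | ⟨n', hn', hlt⟩
      · exact ⟨[], rfl⟩
      · obtain ⟨s, rfl⟩ := ih _ hlt n' rfl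
        exact ⟨a :: s, readSlot_of_valid hv⟩
      · obtain ⟨s, rfl⟩ := ih _ hlt n' rfl
        exact ⟨p :: s, readSlot_of_succ hn'⟩

end Decode

section Tree

variable {G : Type*} [Group G]

/-- The tree of copies of `G` in which every non-identity element of every copy carries exactly
one further copy, attached along its identity. -/
inductive SlotAdj (S : Set G) : List {g : G // g ≠ 1} × G → List {g : G // g ≠ 1} × G → Prop
  | mul (s g x) : x ∈ S → SlotAdj S (s, g) (s, g * x)
  | attach (a : {g : G // g ≠ 1}) (s) : SlotAdj S (a :: s, 1) (s, a)

/-- Labels for the copies attached to the elements of a copy of `G`, where `c g` many are attached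
to `g`. -/
abbrev Letter (c : G → ℕ) := {x : G × ℕ // x.2 < c x.1}

/-- The graph consisting of `m` trees of copies of `G`, with pairwise adjacent roots, in which every
element `g` of every copy carries `c g` further copies, attached along their identities. -/
inductive TreeAdj (S : Set G) (c : G → ℕ) (m : ℕ) :
    (Fin m × List (Letter c)) × G → (Fin m × List (Letter c)) × G → Prop
  | mul (n g x) : x ∈ S → TreeAdj S c m (n, g) (n, g * x)
  | attach (j l u) : TreeAdj S c m ((j, l :: u), 1) ((j, u), l.1.1)
  | top (i j) : TreeAdj S c m ((i, []), 1) ((j, []), 1)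

end Tree

section Chain

variable {G : Type*} [Group G] [DecidableEq G] {c : G → ℕ} {m : ℕ} (p q : G)

/-- The label following `l` in the chain of copies that is to be hung up at a single slot. -/
def nextLetter (b : Bool) (l : Letter c) : Option (Letter c) :=
  if h : l.1.2 + 1 < c l.1.1 then some ⟨(l.1.1, l.1.2 + 1), h⟩
  else if h : (l.1.1 = q ∧ b = true) ∧ 0 < c p then some ⟨(p, 0), h.2⟩
  else if h : (l.1.1 = q ∨ l.1.1 = p ∧ b = true) ∧ 0 < c 1 then some ⟨(1, 0), h.2⟩
  else none

/-- The node to be attached to the slot `p` of the given node, if there is one. -/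
def nextNode (j : Fin m) : List (Letter c) → Option (Fin m × List (Letter c))
  | [] => if h : j.1 + 1 < m then some (⟨j.1 + 1, h⟩, []) else none
  | l :: u => (nextLetter p q (nextNode j u).isSome l).map fun l' => (j, l' :: u)

/-- The first copy attached to a non-identity element. -/
def firstLetter (hc : ∀ g ≠ 1, 0 < c g) (a : {g : G // g ≠ 1}) : Letter c := ⟨(a, 0), hc a a.2⟩

/-- A function increasing along `nextLetter`. -/
def letterRank (M : ℕ) (l : Letter c) : ℕ :=
  l.1.2 + if l.1.1 = 1 then 2 * M else if l.1.1 = p then M else 0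

variable {p q}

theorem nextLetter_injective (hp : p ≠ 1) (hpq : p ≠ q) (hc : ∀ g ≠ 1, 0 < c g)
    {b : Bool} {l l' k : Letter c} (h : nextLetter p q b l = some k)
    (h' : nextLetter p q b l' = some k) : l = l' := by
  obtain ⟨⟨g, i⟩, hi⟩ := l
  obtain ⟨⟨g', i'⟩, hi'⟩ := l'
  obtain ⟨⟨g'', i''⟩, hi''⟩ := k
  have := hc p hp
  simp only [nextLetter] at h h' hi hi' hi''
  grind

theorem nextLetter_ne_first (hc : ∀ g ≠ 1, 0 < c g) {b : Bool} {l : Letter c}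
    {a : {g : G // g ≠ 1}} (h : nextLetter p q b l = some (firstLetter hc a)) :
    b = true ∧ a.1 = p := by
  obtain ⟨⟨g, i⟩, hi⟩ := l
  obtain ⟨a, ha⟩ := a
  simp only [nextLetter, firstLetter] at h hi ⊢
  grind

theorem nextLetter_spec (hp : p ≠ 1) (hq : q ≠ 1) (hpq : p ≠ q) {M : ℕ} (hM : ∀ g, c g ≤ M)
    {b : Bool} {l k : Letter c} (h : nextLetter p q b l = some k) :
    letterRank p M l < letterRank p M k ∧ (l.1.1 = k.1.1 ∨
      (l.1.1 = p ∨ l.1.1 = q) ∧ (k.1.1 = p ∨ k.1.1 = 1)) := by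
  obtain ⟨⟨g, i⟩, hi⟩ := l
  obtain ⟨⟨g', i'⟩, hi'⟩ := k
  have := hM g
  simp only [nextLetter, letterRank] at h hi hi' ⊢
  grind

theorem letter_cover (hp : p ≠ 1) (hq : q ≠ 1) (hpq : p ≠ q) (hc : ∀ g ≠ 1, 0 < c g)
    (b : Bool) (k : Letter c) :
    (∃ a, (b = false ∨ a.1 ≠ p) ∧ firstLetter hc a = k) ∨
      ∃ l, nextLetter p q b l = some k := by
  obtain ⟨⟨g, i⟩, hi⟩ := k
  have h1 := hc p hp
  have h2 := hc q hq
  simp only at hi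
  rcases Nat.eq_zero_or_pos i with rfl | hpos
  · by_cases hg : g = 1
    · subst hg
      right
      cases b
      · exact ⟨⟨(q, c q - 1), by simp; omega⟩, by simp [nextLetter]; grind⟩
      · exact ⟨⟨(p, c p - 1), by simp; omega⟩, by simp [nextLetter]; grind⟩
    · by_cases hb : b = false ∨ g ≠ p
      · exact Or.inl ⟨⟨g, hg⟩, hb, rfl⟩
      · right
        push Not at hb
        obtain ⟨hb, rfl⟩ := hb
        exact ⟨⟨(q, c q - 1), by simp; omega⟩, by simp [nextLetter]; grind⟩
  · right
    exact ⟨⟨(g, i - 1), by simp; omega⟩, by simp [nextLetter]; grind⟩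

end Chain

section TreeSlot

variable {G : Type*} [Group G] {S : Set G} {p q : G}

theorem near_of_mul_edges {Y : Type*} {E : Y × G → Y × G → Prop}
    (h : ∀ n g x, x ∈ S → E (n, g) (n, g * x)) (hp : p ∈ S) (hq : q ∈ S) (n : Y) {x y : G}
    (hx : x = 1 ∨ x = p ∨ x = q) (hy : y = 1 ∨ y = p ∨ y = q) : Near E 2 (n, x) (n, y) := by
  have key : ∀ {x : G}, (x = 1 ∨ x = p ∨ x = q) → Near E 1 (n, 1) (n, x) := by
    rintro x (rfl | rfl | rfl)
    · exact Near.refl _ _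
    · simpa using Near.edge (h n 1 x hp)
    · simpa using Near.edge (h n 1 x hq)
  exact (key hx).symm.trans (key hy)

variable [DecidableEq G] {c : G → ℕ} {m : ℕ}

theorem nextNode_cons (j : Fin m) (l : Letter c) (u : List (Letter c))
    (n : Fin m × List (Letter c)) : nextNode p q j (l :: u) = some n ↔
      ∃ l', nextLetter p q (nextNode p q j u).isSome l = some l' ∧ (j, l' :: u) = n := by
  simp [nextNode]

theorem nextNode_nil (j : Fin m) (n : Fin m × List (Letter c)) :
    nextNode p q j [] = some n ↔ j.1 + 1 = n.1.1 ∧ n.2 = [] := by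
  obtain ⟨i, u⟩ := n
  have := i.2
  simp only [nextNode]
  split
  · simp [Fin.ext_iff, eq_comm]
  · simp only [reduceCtorEq, false_iff]
    omega

variable (p q) in
/-- The decoding of slot words as nodes of the tree given by `c` and `m`. -/
def nodeOfSlots (hp : p ≠ 1) (hc : ∀ g ≠ 1, 0 < c g) (hm : 0 < m) :
    List {g : G // g ≠ 1} → Fin m × List (Letter c) :=
  decode ⟨p, hp⟩ (⟨0, hm⟩, []) (fun n => nextNode p q n.1 n.2)
    fun n a => (n.1, firstLetter hc a :: n.2)

theorem nodeOfSlots_bijective (hp : p ≠ 1) (hq : q ≠ 1) (hpq : p ≠ q)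
    (hc : ∀ g ≠ 1, 0 < c g) (hm : 0 < m) {M : ℕ} (hM : ∀ g, c g ≤ M) :
    Function.Bijective (nodeOfSlots (c := c) p q hp hc hm) := by
  refine decode_bijective (fun n => n.1.1 + (n.2.map fun l => letterRank p M l + 1).sum)
    ?_ ?_ ?_ ?_ ?_ ?_
  · rintro ⟨j, u⟩ ⟨a, ha⟩ ⟨j', u'⟩ ⟨a', ha'⟩ h
    simp only [firstLetter, Prod.mk.injEq, List.cons.injEq, Subtype.mk.injEq, and_true] at h ⊢
    tauto
  · simp
  · rintro ⟨j, _ | ⟨l, u⟩⟩ h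
    · simp [nextNode_nil] at h
    · simp [nextNode_cons] at h
  · rintro ⟨j, _ | ⟨l, u⟩⟩ ⟨j', _ | ⟨l', u'⟩⟩ k h h'
    · rw [nextNode_nil] at h h'
      simp only at h h'
      rw [Prod.mk.injEq, Fin.ext_iff]
      exact ⟨by omega, rfl⟩
    · rw [nextNode_nil] at h
      rw [nextNode_cons] at h'
      obtain ⟨l'', -, rfl⟩ := h'
      simp at h
    · rw [nextNode_nil] at h'
      rw [nextNode_cons] at h
      obtain ⟨l'', -, rfl⟩ := h
      simp at h'
    · rw [nextNode_cons] at h h'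
      obtain ⟨k₁, h, rfl⟩ := h
      obtain ⟨k₂, h', h''⟩ := h'
      simp only [Prod.mk.injEq, List.cons.injEq] at h''
      obtain ⟨rfl, rfl, rfl⟩ := h''
      rw [nextLetter_injective hp hpq hc h h']
  · rintro ⟨j, _ | ⟨l, u⟩⟩ ⟨j', u'⟩ a h
    · simp [nextNode_nil] at h
    · rw [nextNode_cons] at h
      obtain ⟨k, h, h'⟩ := h
      simp only [Prod.mk.injEq, List.cons.injEq] at h'
      obtain ⟨rfl, rfl, rfl⟩ := h'
      have := nextLetter_ne_first hc h
      rw [Option.isSome_iff_ne_none] at this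
      simp only [not_or, not_not]
      exact ⟨this.1, Subtype.ext this.2⟩
  · rintro ⟨⟨j, hj⟩, _ | ⟨k, u⟩⟩
    · rcases Nat.eq_zero_or_pos j with rfl | hpos
      · exact Or.inl rfl
      · refine Or.inr (Or.inr ⟨(⟨j - 1, by omega⟩, []), ?_, ?_⟩)
        · rw [nextNode_nil]
          exact ⟨by simp; omega, rfl⟩
        · simp; omega
    · right
      rcases letter_cover hp hq hpq hc (nextNode p q ⟨j, hj⟩ u).isSome k with
        ⟨a, ha, rfl⟩ | ⟨l, hl⟩
      · refine Or.inl ⟨(⟨j, hj⟩, u), a, ?_, rfl, ?_⟩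
        · simpa [Subtype.ext_iff] using ha
        · simp
      · refine Or.inr ⟨(⟨j, hj⟩, l :: u), (nextNode_cons _ _ _ _).2 ⟨k, hl, rfl⟩, ?_⟩
        have := (nextLetter_spec hp hq hpq hM hl).1
        simpa using this

theorem nodeOfSlots_cons (hp : p ≠ 1) (hc : ∀ g ≠ 1, 0 < c g) (hm : 0 < m)
    (s : List {g : G // g ≠ 1}) (a : {g : G // g ≠ 1}) :
    nodeOfSlots p q hp hc hm (a :: s) = readSlot ⟨p, hp⟩ (fun n => nextNode p q n.1 n.2)
      (fun n a => (n.1, firstLetter hc a :: n.2)) (nodeOfSlots p q hp hc hm s) a :=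
  rfl

theorem nodeOfSlots_of_nextNode (hp : p ≠ 1) (hc : ∀ g ≠ 1, 0 < c g) (hm : 0 < m)
    {s : List {g : G // g ≠ 1}} {n : Fin m × List (Letter c)}
    (h : nextNode p q (nodeOfSlots p q hp hc hm s).1 (nodeOfSlots p q hp hc hm s).2 = some n) :
    nodeOfSlots p q hp hc hm (⟨p, hp⟩ :: s) = n := by
  rw [nodeOfSlots_cons]
  exact readSlot_of_succ h

theorem nodeOfSlots_of_valid (hp : p ≠ 1) (hc : ∀ g ≠ 1, 0 < c g) (hm : 0 < m)
    {s : List {g : G // g ≠ 1}} {n : Fin m × List (Letter c)} {a : {g : G // g ≠ 1}}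
    (hs : nodeOfSlots p q hp hc hm s = n) (h : nextNode p q n.1 n.2 = none ∨ a.1 ≠ p) :
    nodeOfSlots p q hp hc hm (a :: s) = (n.1, firstLetter hc a :: n.2) := by
  subst hs
  rw [nodeOfSlots_cons]
  refine readSlot_of_valid (h.imp_right fun h h' => h ?_)
  rw [h']

theorem coarselyEquivalent_slotAdj_treeAdj (hpS : p ∈ S) (hqS : q ∈ S) (hp : p ≠ 1) (hq : q ≠ 1)
    (hpq : p ≠ q) (hc : ∀ g ≠ 1, 0 < c g) (hm : 0 < m) {M : ℕ} (hM : ∀ g, c g ≤ M) :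
    CoarselyEquivalent (SlotAdj S) (TreeAdj S c m) := by
  obtain ⟨I, hI, hI'⟩ := Function.bijective_iff_has_inverse.1
    (nodeOfSlots_bijective hp hq hpq hc hm hM)
  have hloc : ∀ {b : Bool} {l k : Letter c}, nextLetter p q b l = some k →
      ∀ {Y : Type _} {E : Y × G → Y × G → Prop}, (∀ n g x, x ∈ S → E (n, g) (n, g * x)) →
      ∀ n, Near E 2 (n, l.1.1) (n, k.1.1) := by
    intro b l k h Y E hE n
    rcases (nextLetter_spec hp hq hpq hM h).2 with h | ⟨h1, h2⟩
    · exact Near.of_eq _ (by rw [h])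
    · exact near_of_mul_edges hE hpS hqS n (by tauto) (by tauto)
  have hT : ∀ n g x, x ∈ S → TreeAdj S c m (n, g) (n, g * x) := TreeAdj.mul
  have hL : ∀ n g x, x ∈ S → SlotAdj S (n, g) (n, g * x) := SlotAdj.mul
  have hIp : ∀ n n', nextNode p q n.1 n.2 = some n' → I n' = ⟨p, hp⟩ :: I n := by
    intro n n' h
    rw [← hI (⟨p, hp⟩ :: I n), nodeOfSlots_of_nextNode (n := n') hp hc hm (by rwa [hI'])]
  have hup : ∀ n n', nextNode p q n.1 n.2 = some n' → Near (SlotAdj S) 2 (I n', 1) (I n, 1) := by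
    intro n n' h
    have h1 : Near (SlotAdj S) 1 (I n', 1) (I n, p) := by
      rw [hIp n n' h]
      exact Near.edge (SlotAdj.attach ⟨p, hp⟩ (I n))
    have h2 : Near (SlotAdj S) 1 (I n, 1) (I n, p) := by
      simpa using Near.edge (hL (I n) 1 p hpS)
    exact h1.trans h2.symm
  have hattach : ∀ r j l u, letterRank p M l = r →
      Near (SlotAdj S) (5 * r + 1) (I (j, l :: u), 1) (I (j, u), l.1.1) := by
    intro r
    induction r using Nat.strong_induction_on with
    | _ r ih =>
      rintro j k u rfl
      rcases letter_cover hp hq hpq hc (nextNode p q j u).isSome k with ⟨a, ha, rfl⟩ | ⟨l, hl⟩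
      · have h1 : I (j, firstLetter hc a :: u) = a :: I (j, u) := by
          rw [← hI (a :: I (j, u)), nodeOfSlots_of_valid hp hc hm (hI' (j, u))]
          simpa using ha
        rw [h1]
        exact (Near.edge (SlotAdj.attach a (I (j, u)))).mono (by omega)
      · have hr := (nextLetter_spec hp hq hpq hM hl).1
        have h1 := hup (j, l :: u) (j, k :: u) ((nextNode_cons _ _ _ _).2 ⟨k, hl, rfl⟩)
        exact ((h1.trans (ih _ hr j l u rfl)).trans (hloc hl hL _)).mono (by omega)
  have htop : ∀ i (hi : i < m), Near (SlotAdj S) (2 * i) (I (⟨i, hi⟩, []), 1)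
      (I (⟨0, hm⟩, []), 1) := by
    intro i
    induction i with
    | zero => intro hi; exact Near.refl _ _
    | succ i ih =>
      intro hi
      exact ((hup (⟨i, by omega⟩, []) _ ((nextNode_nil _ _).2 ⟨rfl, rfl⟩)).trans
        (ih (by omega))).mono (by omega)
  refine ⟨5 * (3 * M) + 4 * m + 5, fun y => (nodeOfSlots p q hp hc hm y.1, y.2),
    fun y => (I y.1, y.2), ?_, ?_, fun y => Near.of_eq _ (by simp [hI y.1]),
    fun y => Near.of_eq _ (by simp [hI' y.1])⟩
  · rintro _ _ (⟨s, g, x, hx⟩ | ⟨a, s⟩)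
    · exact (Near.edge (hT _ _ _ hx)).mono (by omega)
    · simp only
      generalize hs : nodeOfSlots p q hp hc hm s = n
      obtain ⟨j, u⟩ := n
      rcases readSlot_cases (p := (⟨p, hp⟩ : {g : G // g ≠ 1}))
        (succ := fun n : Fin m × List (Letter c) => nextNode p q n.1 n.2) (j, u) a with
        ⟨k, hk, rfl⟩ | hv
      · rw [nodeOfSlots_of_nextNode (n := k) hp hc hm (by rw [hs]; exact hk)]
        have h0 : ∀ n, Near (TreeAdj S c m) 1 (n, 1) (n, p) := fun n => by
          simpa using Near.edge (hT n 1 p hpS)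
        cases u with
        | nil =>
          rw [nextNode_nil] at hk
          obtain ⟨k, u⟩ := k
          obtain rfl : u = [] := hk.2
          exact ((Near.edge (TreeAdj.top k j)).trans (h0 _)).mono (by omega)
        | cons l u =>
          rw [nextNode_cons] at hk
          obtain ⟨l', hl', rfl⟩ := hk
          exact ((((Near.edge (TreeAdj.attach j l' u)).trans (hloc hl' hT _).symm).trans
            (Near.edge (TreeAdj.attach j l u)).symm).trans (h0 _)).mono (by omega)
      · rw [nodeOfSlots_of_valid hp hc hm hs (by simpa [Subtype.ext_iff] using hv)]
        exact (Near.edge (TreeAdj.attach j (firstLetter hc a) u)).mono (by omega)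
  · rintro _ _ (⟨n, g, x, hx⟩ | ⟨j, l, u⟩ | ⟨i, j⟩)
    · exact (Near.edge (hL _ _ _ hx)).mono (by omega)
    · refine (hattach _ j l u rfl).mono ?_
      have : letterRank p M l ≤ 3 * M := by
        have := hM l.1.1
        have := l.2
        unfold letterRank
        split_ifs <;> omega
      omega
    · exact ((htop i i.2).trans (htop j j.2).symm).mono (by omega)

end TreeSlot

section Action

variable {G T : Type*} [Group G] [Group T]

theorem closure_coprod {S : Set G} {S' : Set T} (hS : Subgroup.closure S = ⊤)
    (hS' : Subgroup.closure S' = ⊤) :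
    Subgroup.closure (Monoid.Coprod.inl '' S ∪ Monoid.Coprod.inr '' S' :
      Set (Monoid.Coprod G T)) = ⊤ := by
  rw [Subgroup.closure_union, ← MonoidHom.map_closure, ← MonoidHom.map_closure, hS, hS',
    ← MonoidHom.range_eq_map, ← MonoidHom.range_eq_map, Monoid.Coprod.range_inl_sup_range_inr]

/-- The action of `T` on `B × T` by right translations. -/
def mulRightInvPerm (B T : Type*) [Group T] : T →* Equiv.Perm (B × T) where
  toFun t := Equiv.prodCongrRight fun _ => Equiv.mulRight t⁻¹
  map_one' := by ext <;> simp
  map_mul' a b := by ext <;> simp [mul_assoc]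

variable {c : G → ℕ} {m : ℕ}

/-- The element of the free product leading from the root to the given copy of `G`, when the copy
labelled `l` hanging at the node `(j, u)` is reached by `e j u l` and the `j`-th root is reached by
`e₀ j`. -/
def pathProd (e₀ : Fin m → T) (e : Fin m → List (Letter c) → Letter c → T) (j : Fin m) :
    List (Letter c) → Monoid.Coprod G T
  | [] => Monoid.Coprod.inr (e₀ j)
  | l :: u => pathProd e₀ e j u * Monoid.Coprod.inl l.1.1 * Monoid.Coprod.inr (e j u l)

/-- If the orbits of `T` on the vertices of `TreeAdj S c m` are parametrized suitably by `φ`, then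
`TreeAdj S c m` is a model for the free product of `G` and `T`. -/
theorem coarselyEquivalent_coprod_treeAdj {S : Set G} (hS : Subgroup.closure S = ⊤) {t : T}
    (ht : Subgroup.closure {t} = ⊤)
    (φ : (Fin m × List (Letter c)) × G ≃ Option ((Fin m × List (Letter c)) × {g : G // g ≠ 1}) × T)
    (e₀ : Fin m → T) (e : Fin m → List (Letter c) → Letter c → T) {F : Set T} (hF : F.Finite)
    (heF : ∀ j u l, e j u l ∈ F) {j₀ : Fin m} (hj₀ : e₀ j₀ = 1)
    (φ_ne : ∀ n (g : {g : G // g ≠ 1}), φ (n, g) = (some (n, g), 1))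
    (φ_nil : ∀ j, φ ((j, []), 1) = (none, e₀ j))
    (φ_cons : ∀ j u l, φ ((j, l :: u), 1) =
      ((φ ((j, u), l.1.1)).1, (φ ((j, u), l.1.1)).2 * e j u l))
    {K : ℕ} (hK : ∀ b x, Near (TreeAdj S c m) K (φ.symm (b, x)) (φ.symm (b, x * t⁻¹))) :
    CoarselyEquivalent (CayleyAdj (Monoid.Coprod.inl '' S ∪ Monoid.Coprod.inr '' {t} :
      Set (Monoid.Coprod G T))) (TreeAdj S c m) := by
  classical
  have hcl := closure_coprod hS ht
  set S' : Set (Monoid.Coprod G T) := Monoid.Coprod.inl '' S ∪ Monoid.Coprod.inr '' {t} with hS'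
  let β : T →* Equiv.Perm ((Fin m × List (Letter c)) × G) :=
    φ.symm.permCongrHom.toMonoidHom.comp (mulRightInvPerm _ T)
  let α : Monoid.Coprod G T →* Equiv.Perm ((Fin m × List (Letter c)) × G) :=
    Monoid.Coprod.lift (mulRightInvPerm _ G) β
  have hαl : ∀ g n h, α (Monoid.Coprod.inl g) (n, h) = (n, h * g⁻¹) := fun g n h => rfl
  have hαr : ∀ x y, α (Monoid.Coprod.inr x) y = φ.symm ((φ y).1, (φ y).2 * x⁻¹) :=
    fun x y => rfl
  let ρ : (Fin m × List (Letter c)) → Monoid.Coprod G T := fun n => pathProd e₀ e n.1 n.2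
  let R : Option ((Fin m × List (Letter c)) × {g : G // g ≠ 1}) → Monoid.Coprod G T :=
    fun b => b.elim 1 fun y => ρ y.1 * Monoid.Coprod.inl y.2.1
  let r : (Fin m × List (Letter c)) × G → Monoid.Coprod G T :=
    fun y => ρ y.1 * Monoid.Coprod.inl y.2
  have hrφ : ∀ u j g, r ((j, u), g) =
      R (φ ((j, u), g)).1 * Monoid.Coprod.inr (φ ((j, u), g)).2 := by
    intro u
    induction u with
    | nil =>
      intro j g
      by_cases hg : g = 1
      · subst hg
        rw [φ_nil]
        simp [r, R, ρ, pathProd]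
      · rw [φ_ne (j, []) ⟨g, hg⟩]
        simp [r, R]
    | cons l u ih =>
      intro j g
      by_cases hg : g = 1
      · subst hg
        rw [φ_cons, map_mul, ← mul_assoc, ← ih]
        simp [r, ρ, pathProd]
      · rw [φ_ne (j, l :: u) ⟨g, hg⟩]
        simp [r, R]
  obtain ⟨K₁, hK₁⟩ := exists_near_mul_of_finite hcl (hF.image Monoid.Coprod.inr)
  obtain ⟨K₂, hK₂⟩ := exists_near_mul_of_finite hcl
    (Set.finite_range fun ij : Fin m × Fin m =>
      (Monoid.Coprod.inr ((e₀ ij.1)⁻¹ * e₀ ij.2) : Monoid.Coprod G T))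
  refine CoarselyEquivalent.of_action (K := K + K₁ + K₂ + 1) α ((j₀, []), 1) r hcl ?_ ?_ ?_ ?_ ?_
  · rintro _ (⟨s, hs, rfl⟩ | ⟨s, hs, rfl⟩) y
    · obtain ⟨n, g⟩ := y
      rw [hαl]
      have h1 : TreeAdj S c m (n, g * s⁻¹) (n, g * s⁻¹ * s) := TreeAdj.mul _ _ _ hs
      rw [inv_mul_cancel_right] at h1
      exact (Near.edge h1).symm.mono (by omega)
    · obtain rfl : s = t := hs
      rw [hαr]
      have := hK (φ y).1 (φ y).2
      rw [Prod.mk.eta, Equiv.symm_apply_apply] at this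
      exact this.mono (by omega)
  · rintro _ (⟨s, hs, rfl⟩ | ⟨s, hs, rfl⟩) ⟨⟨j, u⟩, g⟩
    · rw [hαl]
      simp [r, mul_assoc]
    · rw [hαr]
      generalize hy : φ.symm ((φ ((j, u), g)).1, (φ ((j, u), g)).2 * s⁻¹) = y
      obtain ⟨⟨j', u'⟩, g'⟩ := y
      rw [hrφ, hrφ, ← hy, Equiv.apply_symm_apply]
      simp [mul_assoc]
  · rintro _ _ (⟨n, g, x, hx⟩ | ⟨j, l, u⟩ | ⟨i, j⟩)
    · have h1 : CayleyAdj S' (r (n, g)) (r (n, g * x)) :=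
        ⟨Monoid.Coprod.inl x, Or.inl ⟨x, hx, rfl⟩, by simp [r, mul_assoc]⟩
      exact (Near.edge h1).mono (by omega)
    · have h1 := hK₁ _ ⟨_, heF j u l, rfl⟩ (r ((j, u), l.1.1))
      have h2 : r ((j, u), l.1.1) * Monoid.Coprod.inr (e j u l) = r ((j, l :: u), 1) := by
        simp [r, ρ, pathProd]
      rw [h2] at h1
      exact h1.symm.mono (by omega)
    · have h1 := hK₂ _ ⟨(i, j), rfl⟩ (r ((i, []), 1))
      have h2 : r ((i, []), 1) * Monoid.Coprod.inr ((e₀ i)⁻¹ * e₀ j) = r ((j, []), 1) := by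
        simp [r, ρ, pathProd]
      rw [h2] at h1
      exact h1.mono (by omega)
  · simp [r, ρ, pathProd, hj₀]
  · rintro ⟨⟨j, u⟩, g⟩
    have h1 : ∀ n, α (Monoid.Coprod.inl g) (n, g) = (n, 1) := fun n => by rw [hαl]; simp
    rw [map_inv, Equiv.Perm.inv_eq_iff_eq]
    symm
    induction u generalizing g with
    | nil =>
      simp only [r, ρ, pathProd, map_mul, Equiv.Perm.mul_apply, h1]
      rw [hαr, Equiv.symm_apply_eq, φ_nil, φ_nil, hj₀]
      simp
    | cons l u ih =>
      simp only [r, ρ, pathProd, map_mul, Equiv.Perm.mul_apply, h1]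
      rw [hαr, φ_cons]
      simp only [mul_inv_cancel_right, Prod.mk.eta, Equiv.symm_apply_apply]
      have := ih l.1.1 fun n => by rw [hαl]; simp
      rwa [map_mul, Equiv.Perm.mul_apply] at this

end Action

section FiniteFactor

variable {G T : Type*} [Group G] [Group T] [DecidableEq G] {k : ℕ}

/-- Exactly `k` copies are to be attached to every non-identity element. -/
def constMult (k : ℕ) (g : G) : ℕ := if g = 1 then 0 else k

theorem ne_one_of_lt_constMult {i : ℕ} {g : G} (h : i < constMult k g) : g ≠ 1 := by
  rintro rfl
  simp [constMult] at h

theorem lt_of_lt_constMult {i : ℕ} {g : G} (h : i < constMult k g) : i < k := by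
  rwa [constMult, if_neg (ne_one_of_lt_constMult h)] at h

/-- The position of a letter in its orbit. -/
def letterPos (l : Letter (constMult (G := G) k)) : Fin (k + 1) :=
  Fin.succ ⟨l.1.2, lt_of_lt_constMult l.2⟩

/-- The parametrization of the vertices of the tree by the orbits of a group with `k + 1`
elements. -/
def finiteOrbitEquiv (θ : Fin (k + 1) ≃ T) (hθ : θ 0 = 1) :
    (Fin (k + 1) × List (Letter (constMult (G := G) k))) × G ≃
      Option ((Fin (k + 1) × List (Letter (constMult (G := G) k))) × {g : G // g ≠ 1}) × T where
  toFun
    | ((j, u), g) => if hg : g = 1 then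
        match u with
        | [] => (none, θ j)
        | l :: u => (some ((j, u), ⟨l.1.1, ne_one_of_lt_constMult l.2⟩), θ (letterPos l))
      else (some ((j, u), ⟨g, hg⟩), 1)
  invFun
    | (none, x) => ((θ.symm x, []), 1)
    | (some (n, g), x) => Fin.cases (n, g.1)
        (fun i => ((n.1, ⟨(g.1, i), by simp [constMult, g.2]⟩ :: n.2), 1)) (θ.symm x)
  left_inv := by
    have hθ' : θ.symm 1 = 0 := by rw [← hθ, Equiv.symm_apply_apply]
    rintro ⟨⟨j, _ | ⟨l, u⟩⟩, g⟩ <;> by_cases hg : g = 1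
    · simp [hg]
    · simp [hg, hθ']
    · simp [hg, letterPos]
    · simp [hg, hθ']
  right_inv := by
    have hθ' : θ.symm 1 = 0 := by rw [← hθ, Equiv.symm_apply_apply]
    rintro ⟨_ | ⟨⟨j, u⟩, g⟩, x⟩
    · simp
    · obtain ⟨y, rfl⟩ := θ.surjective x
      obtain ⟨g, hg⟩ := g
      cases y using Fin.cases with
      | zero => simp [hg, hθ, hθ']
      | succ i => simp [letterPos]

theorem coarselyEquivalent_finite_coprod {S : Set G} (hS : Subgroup.closure S = ⊤) {t : T}
    (ht : Subgroup.closure {t} = ⊤) (θ : Fin (k + 1) ≃ T) (hθ : θ 0 = 1) :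
    CoarselyEquivalent (CayleyAdj (Monoid.Coprod.inl '' S ∪ Monoid.Coprod.inr '' {t} :
      Set (Monoid.Coprod G T))) (TreeAdj S (constMult k) (k + 1)) := by
  have : Finite T := Finite.of_equiv _ θ
  have hθ' : θ.symm 1 = 0 := by rw [← hθ, Equiv.symm_apply_apply]
  refine coarselyEquivalent_coprod_treeAdj hS ht (finiteOrbitEquiv θ hθ) θ
    (fun _ _ l => θ (letterPos l)) (Set.toFinite Set.univ) (fun _ _ _ => trivial) hθ ?_ ?_ ?_
    (K := 2) ?_
  · rintro n ⟨g, hg⟩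
    simp [finiteOrbitEquiv, hg]
  · intro j
    simp [finiteOrbitEquiv]
  · intro j u l
    simp [finiteOrbitEquiv, ne_one_of_lt_constMult l.2]
  · intro b x
    have key : ∀ x, Near (TreeAdj S (constMult k) (k + 1)) 1
        ((finiteOrbitEquiv θ hθ).symm (b, x)) ((finiteOrbitEquiv θ hθ).symm (b, 1)) := by
      intro x
      rcases b with _ | ⟨n, g⟩
      · exact Near.edge (TreeAdj.top _ _)
      · obtain ⟨y, rfl⟩ := θ.surjective x
        cases y using Fin.cases with
        | zero => exact Near.of_eq _ (by rw [hθ])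
        | succ i =>
          have h1 : TreeAdj S (constMult k) (k + 1) _ _ :=
            TreeAdj.attach n.1 ⟨(g.1, i), by simp [constMult, g.2]⟩ n.2
          simpa [finiteOrbitEquiv, hθ'] using Near.edge h1
    exact (key x).trans (key _).symm

end FiniteFactor

section IntFactor

variable {G : Type*} [Group G] [DecidableEq G]

/-- One copy is to be attached to the identity and two to every other element. -/
def lineMult (g : G) : ℕ := if g = 1 then 1 else 2

theorem lineMult_one : lineMult (1 : G) = 1 := if_pos rfl

theorem lineMult_of_ne {g : G} (hg : g ≠ 1) : lineMult g = 2 := if_neg hg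

/-- The letter at the identity. -/
def oneLetter : Letter (lineMult (G := G)) := ⟨(1, 0), by simp [lineMult]⟩

theorem eq_oneLetter {l : Letter (lineMult (G := G))} (hl : l.1.1 = 1) : l = oneLetter := by
  obtain ⟨⟨g, i⟩, hi⟩ := l
  obtain rfl : g = 1 := hl
  simp only [lineMult_one, Nat.lt_one_iff] at hi
  subst hi
  rfl

/-- The position of the identity of a copy in its orbit under `ℤ`. -/
def linePos (j : Fin 2) : List (Letter (lineMult (G := G))) →
    Option ((Fin 2 × List (Letter (lineMult (G := G)))) × {g : G // g ≠ 1}) × ℤ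
  | [] => (none, j.1)
  | l :: u => if hl : l.1.1 = 1 then
      ((linePos j u).1, (linePos j u).2 + if 0 < (linePos j u).2 then 1 else -1)
    else (some ((j, u), ⟨l.1.1, hl⟩), if l.1.2 = 0 then 1 else -1)

theorem linePos_cons_of_ne (j : Fin 2) {l : Letter (lineMult (G := G))} (hl : l.1.1 ≠ 1)
    (u : List (Letter (lineMult (G := G)))) : linePos j (l :: u) =
      (some ((j, u), ⟨l.1.1, hl⟩), if l.1.2 = 0 then 1 else -1) :=
  dif_neg hl

/-- The vertex with the given position in its orbit under `ℤ`. -/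
def lineVertex : Option ((Fin 2 × List (Letter (lineMult (G := G)))) × {g : G // g ≠ 1}) → ℤ →
    (Fin 2 × List (Letter (lineMult (G := G)))) × G
  | none, Int.ofNat 0 => ((0, []), 1)
  | none, Int.ofNat (a + 1) => ((1, List.replicate a oneLetter), 1)
  | none, Int.negSucc a => ((0, List.replicate (a + 1) oneLetter), 1)
  | some (n, g), Int.ofNat 0 => (n, g)
  | some (n, g), Int.ofNat (a + 1) => ((n.1, List.replicate a oneLetter ++
      ⟨(g, 0), by simp [lineMult, g.2]⟩ :: n.2), 1)
  | some (n, g), Int.negSucc a => ((n.1, List.replicate a oneLetter ++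
      ⟨(g, 1), by simp [lineMult, g.2]⟩ :: n.2), 1)

theorem lineVertex_push {b} {x : ℤ} {j : Fin 2} {u : List (Letter (lineMult (G := G)))}
    (h : lineVertex b x = ((j, u), 1)) :
    lineVertex b (x + if 0 < x then 1 else -1) = ((j, oneLetter :: u), 1) := by
  rcases b with _ | ⟨n, g, hg⟩ <;> rcases x with (_ | a) | a
  · simp only [lineVertex, Prod.mk.injEq, and_true] at h
    obtain ⟨rfl, rfl⟩ := h
    rfl
  · have h1 : (0 : ℤ) < Int.ofNat (a + 1) := by simp
    rw [if_pos h1]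
    change lineVertex none (Int.ofNat (a + 1 + 1)) = _
    simp only [lineVertex, Prod.mk.injEq, and_true] at h ⊢
    obtain ⟨rfl, rfl⟩ := h
    exact ⟨rfl, rfl⟩
  · have h1 : ¬ (0 : ℤ) < Int.negSucc a := by simp
    rw [if_neg h1]
    change lineVertex none (Int.negSucc (a + 1)) = _
    simp only [lineVertex, Prod.mk.injEq, and_true] at h ⊢
    obtain ⟨rfl, rfl⟩ := h
    exact ⟨rfl, rfl⟩
  · simp [lineVertex, hg] at h
  · have h1 : (0 : ℤ) < Int.ofNat (a + 1) := by simp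
    rw [if_pos h1]
    change lineVertex _ (Int.ofNat (a + 1 + 1)) = _
    simp only [lineVertex, Prod.mk.injEq, and_true] at h ⊢
    obtain ⟨rfl, rfl⟩ := h
    exact ⟨rfl, rfl⟩
  · have h1 : ¬ (0 : ℤ) < Int.negSucc a := by simp
    rw [if_neg h1]
    change lineVertex _ (Int.negSucc (a + 1)) = _
    simp only [lineVertex, Prod.mk.injEq, and_true] at h ⊢
    obtain ⟨rfl, rfl⟩ := h
    exact ⟨rfl, rfl⟩

theorem lineVertex_linePos (j : Fin 2) (u : List (Letter (lineMult (G := G)))) :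
    lineVertex (linePos j u).1 (linePos j u).2 = ((j, u), 1) := by
  induction u with
  | nil => fin_cases j <;> rfl
  | cons l u ih =>
    by_cases hl : l.1.1 = 1
    · have := lineVertex_push ih
      rw [linePos, dif_pos hl, this, eq_oneLetter hl]
    · obtain ⟨⟨g, i⟩, hi⟩ := l
      rw [lineMult_of_ne hl] at hi
      rw [linePos, dif_neg hl]
      interval_cases i <;> rfl

theorem linePos_push {b} {x : ℤ} {j : Fin 2} {u : List (Letter (lineMult (G := G)))}
    (h : linePos j u = (b, x)) :
    linePos j (oneLetter :: u) = (b, x + if 0 < x then 1 else -1) := by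
  simp [linePos, h, oneLetter]

theorem linePos_replicate {b} {x : ℤ} {j : Fin 2} {u : List (Letter (lineMult (G := G)))}
    (h : linePos j u = (b, x)) (a : ℕ) :
    linePos j (List.replicate a oneLetter ++ u) = (b, x + if 0 < x then (a : ℤ) else -a) := by
  induction a with
  | zero => simpa using h
  | succ a ih =>
    rw [List.replicate_succ, List.cons_append, linePos_push ih]
    grind

/-- The parametrization of the vertices of the tree by the orbits of `ℤ`. -/
def lineOrbitEquiv : (Fin 2 × List (Letter (lineMult (G := G)))) × G ≃
    Option ((Fin 2 × List (Letter (lineMult (G := G)))) × {g : G // g ≠ 1}) × Multiplicative ℤ where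
  toFun y := if hg : y.2 = 1 then
      ((linePos y.1.1 y.1.2).1, Multiplicative.ofAdd (linePos y.1.1 y.1.2).2)
    else (some (y.1, ⟨y.2, hg⟩), 1)
  invFun z := lineVertex z.1 z.2.toAdd
  left_inv := by
    rintro ⟨⟨j, u⟩, g⟩
    by_cases hg : g = 1
    · subst hg
      simpa using lineVertex_linePos j u
    · simp only [dif_neg hg]
      rfl
  right_inv := by
    have key : ∀ b x j u, lineVertex b x = ((j, u), (1 : G)) → ∀ y, linePos j u = (b, y) → y = x →
        (if hg : (lineVertex b x).2 = 1 then
          ((linePos (lineVertex b x).1.1 (lineVertex b x).1.2).1,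
            Multiplicative.ofAdd (linePos (lineVertex b x).1.1 (lineVertex b x).1.2).2)
        else (some ((lineVertex b x).1, ⟨(lineVertex b x).2, hg⟩), 1)) =
          (b, Multiplicative.ofAdd x) := by
      rintro b x j u h y h' rfl
      simp [h, h']
    rintro ⟨b, x⟩
    obtain ⟨x, rfl⟩ := Multiplicative.ofAdd.surjective x
    rcases b with _ | ⟨n, g, hg⟩ <;> rcases x with (_ | a) | a
    · exact key _ _ _ _ rfl _ rfl rfl
    · have h := linePos_replicate (G := G) (j := 1) (u := []) rfl a
      rw [List.append_nil] at h
      exact key _ _ _ _ rfl _ h (by simp [add_comm])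
    · have h := linePos_replicate (G := G) (j := 0) (u := []) rfl (a + 1)
      rw [List.append_nil] at h
      exact key _ _ _ _ rfl _ h (by simp [Int.negSucc_eq])
    · exact dif_neg hg
    · refine key _ _ _ _ rfl _ (linePos_replicate
        (linePos_cons_of_ne _ (l := ⟨(g, 0), by simp [lineMult, hg]⟩) hg _) a) ?_
      simp [add_comm]
    · refine key _ _ _ _ rfl _ (linePos_replicate
        (linePos_cons_of_ne _ (l := ⟨(g, 1), by simp [lineMult, hg]⟩) hg _) a) ?_
      simp [Int.negSucc_eq]

theorem near_lineVertex_succ (S : Set G) (b) (x : ℤ) :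
    Near (TreeAdj S lineMult 2) 1 (lineVertex b x) (lineVertex b (x + 1)) := by
  rcases b with _ | ⟨n, g, hg⟩ <;> rcases x with (_ | a) | (_ | a)
  · exact Near.edge (TreeAdj.top 0 1)
  · exact (Near.edge (TreeAdj.attach 1 oneLetter (List.replicate a oneLetter))).symm
  · exact Near.edge (TreeAdj.attach 0 oneLetter [])
  · exact Near.edge (TreeAdj.attach 0 oneLetter (List.replicate (a + 1) oneLetter))
  · exact (Near.edge (TreeAdj.attach n.1 ⟨(g, 0), by simp [lineMult, hg]⟩ n.2)).symm
  · exact (Near.edge (TreeAdj.attach n.1 oneLetter (List.replicate a oneLetter ++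
      ⟨(g, 0), by simp [lineMult, hg]⟩ :: n.2))).symm
  · exact Near.edge (TreeAdj.attach n.1 ⟨(g, 1), by simp [lineMult, hg]⟩ n.2)
  · exact Near.edge (TreeAdj.attach n.1 oneLetter (List.replicate a oneLetter ++
      ⟨(g, 1), by simp [lineMult, hg]⟩ :: n.2))

theorem coarselyEquivalent_int_coprod {S : Set G} (hS : Subgroup.closure S = ⊤)
    (ht : Subgroup.closure {Multiplicative.ofAdd (1 : ℤ)} = ⊤) :
    CoarselyEquivalent (CayleyAdj (Monoid.Coprod.inl '' S ∪
      Monoid.Coprod.inr '' {Multiplicative.ofAdd (1 : ℤ)} :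
        Set (Monoid.Coprod G (Multiplicative ℤ)))) (TreeAdj S lineMult 2) := by
  refine coarselyEquivalent_coprod_treeAdj hS ht lineOrbitEquiv
    (fun j => Multiplicative.ofAdd (j.1 : ℤ)) (fun j u l => Multiplicative.ofAdd
      (if l.1.1 = 1 then if 0 < (linePos j u).2 then 1 else -1 else if l.1.2 = 0 then 1 else -1))
    (F := {Multiplicative.ofAdd 1, Multiplicative.ofAdd (-1)}) (Set.toFinite _) ?_ (j₀ := 0) rfl
    ?_ ?_ ?_ (K := 1) ?_
  · intro j u l
    simp only [Set.mem_insert_iff, Set.mem_singleton_iff]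
    split_ifs <;> simp
  · rintro n ⟨g, hg⟩
    simp [lineOrbitEquiv, hg]
  · intro j
    simp [lineOrbitEquiv, linePos]
  · intro j u l
    by_cases hl : l.1.1 = 1
    · simp [lineOrbitEquiv, linePos, hl, ofAdd_add]
    · simp [lineOrbitEquiv, linePos, hl]
  · intro b x
    have := near_lineVertex_succ S b (x.toAdd - 1)
    rw [sub_add_cancel] at this
    exact this.symm

end IntFactor

section SemidirectProduct

variable {G N : Type*} [Group G] [Group N] {n : ℕ}

theorem closure_ofAdd_one_zmod (n : ℕ) :
    Subgroup.closure {Multiplicative.ofAdd (1 : ZMod n)} = ⊤ := by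
  rw [eq_top_iff]
  intro x _
  obtain ⟨x, rfl⟩ := Multiplicative.ofAdd.surjective x
  obtain ⟨z, rfl⟩ := ZMod.intCast_surjective x
  rw [Subgroup.mem_closure_singleton]
  exact ⟨z, by rw [← ofAdd_zsmul, zsmul_one]⟩

theorem orderOf_ofAdd_one_zmod (n : ℕ) : orderOf (Multiplicative.ofAdd (1 : ZMod n)) = n := by
  rw [orderOf_ofAdd_eq_addOrderOf, ZMod.addOrderOf_one]

theorem coarselyEquivalent_coprod_zmod [NeZero n] (σ : MulAut N) (hσ : σ ^ n = 1) (ι : G →* N)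
    (hgen : Subgroup.closure {x | ∃ (i : ℕ) (g : G), x = (σ ^ i) (ι g)} = ⊤)
    (F : N →* Monoid.Coprod G (Multiplicative (ZMod n))) (hFι : ∀ g, F (ι g) = Monoid.Coprod.inl g)
    (hFσ : ∀ x, F (σ x) = Monoid.Coprod.inr (Multiplicative.ofAdd 1) * F x *
      (Monoid.Coprod.inr (Multiplicative.ofAdd 1))⁻¹)
    {S : Set N} (hSf : S.Finite) (hS : Subgroup.closure S = ⊤)
    {T : Set (Monoid.Coprod G (Multiplicative (ZMod n)))} (hTf : T.Finite)
    (hT : Subgroup.closure T = ⊤) : CoarselyEquivalent (CayleyAdj S) (CayleyAdj T) := by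
  set t : Multiplicative (ZMod n) := Multiplicative.ofAdd 1 with ht
  have hpow : ∀ x : Multiplicative (ZMod n), ∃ i : ℕ, x = t ^ i := by
    intro x
    refine ⟨x.toAdd.val, ?_⟩
    rw [ht, ← ofAdd_nsmul, nsmul_one, ZMod.natCast_zmod_val]
    rfl
  have htop : ∀ x, x ∈ Subgroup.zpowers t := by
    intro x
    obtain ⟨i, rfl⟩ := hpow x
    exact Subgroup.npow_mem_zpowers t i
  let φ : Multiplicative (ZMod n) →* MulAut N := monoidHomOfForallMemZpowers htop
    (g' := σ) (by rw [ht, orderOf_ofAdd_one_zmod]; exact orderOf_dvd_of_pow_eq_one hσ)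
  have hφ : φ t = σ := monoidHomOfForallMemZpowers_apply_gen _ _
  have hFσ' : ∀ (i : ℕ) x, F ((σ ^ i) x) =
      Monoid.Coprod.inr (t ^ i) * F x * (Monoid.Coprod.inr (t ^ i))⁻¹ := by
    intro i
    induction i with
    | zero => simp
    | succ i ih =>
      intro x
      rw [pow_succ', MulAut.mul_apply, hFσ, ih, pow_succ', map_mul]
      group
  let Φ : N ⋊[φ] Multiplicative (ZMod n) →* Monoid.Coprod G (Multiplicative (ZMod n)) :=
    SemidirectProduct.lift F Monoid.Coprod.inr (by
      intro x
      obtain ⟨i, rfl⟩ := hpow x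
      ext y
      simp only [MonoidHom.comp_apply, MulEquiv.coe_toMonoidHom, hFσ', hφ,
        map_pow φ, MulAut.conj_apply])
  let Ψ : Monoid.Coprod G (Multiplicative (ZMod n)) →* N ⋊[φ] Multiplicative (ZMod n) :=
    Monoid.Coprod.lift (SemidirectProduct.inl.comp ι) SemidirectProduct.inr
  have hΦΨ : ∀ x, F (Ψ x).left * Monoid.Coprod.inr (Ψ x).right = x := by
    have : Φ.comp Ψ = MonoidHom.id _ := by
      ext x <;> simp [Φ, Ψ, hFι]
    intro x
    exact DFunLike.congr_fun this x
  have hΨF : ∀ x, Ψ (F x) = SemidirectProduct.inl x := by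
    have : Ψ.comp F = SemidirectProduct.inl := by
      refine MonoidHom.eq_of_eqOn_dense hgen ?_
      rintro _ ⟨i, g, rfl⟩
      have h1 : (SemidirectProduct.inl ((σ ^ i) (ι g)) : N ⋊[φ] Multiplicative (ZMod n)) =
          SemidirectProduct.inr (t ^ i) * SemidirectProduct.inl (ι g) *
            SemidirectProduct.inr (t ^ i)⁻¹ := by
        rw [← SemidirectProduct.inl_aut, map_pow, hφ]
      rw [h1, MonoidHom.comp_apply, hFσ', hFι]
      simp [Ψ]
    exact fun x => DFunLike.congr_fun this x
  obtain ⟨K₁, hK₁⟩ := exists_near_mul_of_finite hT (hSf.image F)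
  obtain ⟨K₂, hK₂⟩ := exists_near_mul_of_finite hT (Set.finite_range
    (Monoid.Coprod.inr : Multiplicative (ZMod n) →* Monoid.Coprod G (Multiplicative (ZMod n))))
  obtain ⟨K₃, hK₃⟩ := exists_near_mul_of_finite hS
    ((Set.finite_univ (α := Multiplicative (ZMod n))).image2 (fun x y => φ x (Ψ y).left) hTf)
  refine ⟨K₁ + K₂ + K₃, F, fun x => (Ψ x).left, ?_, ?_, fun x => Near.of_eq _ ?_, fun x => ?_⟩
  · rintro x _ ⟨s, hs, rfl⟩
    rw [map_mul]
    exact (hK₁ _ ⟨s, hs, rfl⟩ (F x)).mono (by omega)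
  · rintro x _ ⟨s, hs, rfl⟩
    change Near _ _ (Ψ x).left (Ψ (x * s)).left
    rw [map_mul, SemidirectProduct.mul_left]
    exact (hK₃ _ ⟨(Ψ x).right, trivial, s, hs, rfl⟩ _).mono (by omega)
  · simp only [hΨF, SemidirectProduct.left_inl]
  · have h1 := hK₂ _ ⟨(Ψ x).right, rfl⟩ (F (Ψ x).left)
    rw [hΦΨ] at h1
    exact h1.symm.mono (by omega)

/-- The automorphism of `(G * G) * G` permuting the factors cyclically. -/
def coprodRotate (G : Type*) [Group G] : MulAut (Monoid.Coprod (Monoid.Coprod G G) G) :=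
  MonoidHom.toMulEquiv
    (Monoid.Coprod.lift (Monoid.Coprod.lift (Monoid.Coprod.inl.comp Monoid.Coprod.inr)
      Monoid.Coprod.inr) (Monoid.Coprod.inl.comp Monoid.Coprod.inl))
    (Monoid.Coprod.lift (Monoid.Coprod.lift Monoid.Coprod.inr
      (Monoid.Coprod.inl.comp Monoid.Coprod.inl)) (Monoid.Coprod.inl.comp Monoid.Coprod.inr))
    (by ext <;> simp) (by ext <;> simp)

theorem coprodRotate_first (g : G) : coprodRotate G (Monoid.Coprod.inl (Monoid.Coprod.inl g)) =
    Monoid.Coprod.inl (Monoid.Coprod.inr g) := by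
  simp [coprodRotate]

theorem coprodRotate_second (g : G) : coprodRotate G (Monoid.Coprod.inl (Monoid.Coprod.inr g)) =
    Monoid.Coprod.inr g := by
  simp [coprodRotate]

theorem coprodRotate_third (g : G) : coprodRotate G (Monoid.Coprod.inr g) =
    Monoid.Coprod.inl (Monoid.Coprod.inl g) := by
  simp [coprodRotate]

theorem coarselyEquivalent_coprod_self {S : Set G} (hSf : S.Finite)
    (hS : Subgroup.closure S = ⊤) {T : Set (Monoid.Coprod G (Multiplicative (ZMod 2)))}
    (hTf : T.Finite) (hT : Subgroup.closure T = ⊤) :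
    CoarselyEquivalent (CayleyAdj (Monoid.Coprod.inl '' S ∪ Monoid.Coprod.inr '' S :
      Set (Monoid.Coprod G G))) (CayleyAdj T) := by
  set t : Multiplicative (ZMod 2) := Multiplicative.ofAdd 1 with ht
  have ht2 : t * t = 1 := by decide
  let C : MulAut (Monoid.Coprod G (Multiplicative (ZMod 2))) := MulAut.conj (Monoid.Coprod.inr t)
  have hC : C * C = 1 := by
    rw [← map_mul, ← map_mul, ht2, map_one, map_one]
  let F : Monoid.Coprod G G →* Monoid.Coprod G (Multiplicative (ZMod 2)) :=
    Monoid.Coprod.lift Monoid.Coprod.inl (C.toMonoidHom.comp Monoid.Coprod.inl)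
  refine coarselyEquivalent_coprod_zmod (MulEquiv.coprodComm G G) ?_ Monoid.Coprod.inl ?_ F
    (fun g => ?_) (fun x => ?_) ((hSf.image _).union (hSf.image _)) (closure_coprod hS hS) hTf hT
  · ext x
    simp [pow_two, MulAut.mul_apply]
  · rw [eq_top_iff, ← Monoid.Coprod.closure_range_inl_union_inr]
    apply Subgroup.closure_mono
    rintro _ (⟨g, rfl⟩ | ⟨g, rfl⟩)
    · exact ⟨0, g, rfl⟩
    · exact ⟨1, g, by simp⟩
  · simp [F]
  · rw [← ht, ← MulAut.conj_apply]
    suffices h : F.comp (MulEquiv.coprodComm G G).toMonoidHom = C.toMonoidHom.comp F from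
      DFunLike.congr_fun h x
    ext g
    · simp [F]
    · have := DFunLike.congr_fun hC (Monoid.Coprod.inl g)
      simp only [MulAut.mul_apply, MulAut.one_apply] at this
      simp [F, this]

theorem coarselyEquivalent_coprod_coprod_self {S : Set G} (hSf : S.Finite)
    (hS : Subgroup.closure S = ⊤) {T : Set (Monoid.Coprod G (Multiplicative (ZMod 3)))}
    (hTf : T.Finite) (hT : Subgroup.closure T = ⊤) :
    CoarselyEquivalent (CayleyAdj (Monoid.Coprod.inl '' (Monoid.Coprod.inl '' S ∪
      Monoid.Coprod.inr '' S) ∪ Monoid.Coprod.inr '' S :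
        Set (Monoid.Coprod (Monoid.Coprod G G) G))) (CayleyAdj T) := by
  set t : Multiplicative (ZMod 3) := Multiplicative.ofAdd 1 with ht
  have ht3 : t * t * t = 1 := by decide
  let C : MulAut (Monoid.Coprod G (Multiplicative (ZMod 3))) := MulAut.conj (Monoid.Coprod.inr t)
  have hC : C * C * C = 1 := by
    rw [← map_mul, ← map_mul, ← map_mul, ← map_mul, ht3, map_one, map_one]
  let F : Monoid.Coprod (Monoid.Coprod G G) G →* Monoid.Coprod G (Multiplicative (ZMod 3)) :=
    Monoid.Coprod.lift (Monoid.Coprod.lift Monoid.Coprod.inl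
      (C.toMonoidHom.comp Monoid.Coprod.inl)) ((C * C).toMonoidHom.comp Monoid.Coprod.inl)
  refine coarselyEquivalent_coprod_zmod (coprodRotate G) ?_
    (Monoid.Coprod.inl.comp Monoid.Coprod.inl) ?_ F (fun g => ?_) (fun x => ?_)
    ((((hSf.image _).union (hSf.image _)).image _).union (hSf.image _))
    (closure_coprod (closure_coprod hS hS) hS) hTf hT
  · rw [MulEquiv.ext_iff]
    intro x
    refine DFunLike.congr_fun (f := MulEquiv.toMonoidHom _) (g := MulEquiv.toMonoidHom _) ?_ x
    ext g <;>
    simp [pow_succ, coprodRotate_first, coprodRotate_second, coprodRotate_third]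
  · rw [eq_top_iff, ← closure_coprod (Monoid.Coprod.closure_range_inl_union_inr (G := G) (H := G))
      (Subgroup.closure_univ (G := G))]
    apply Subgroup.closure_mono
    rintro _ (⟨_, ⟨g, rfl⟩ | ⟨g, rfl⟩, rfl⟩ | ⟨g, -, rfl⟩)
    · exact ⟨0, g, rfl⟩
    · exact ⟨1, g, by simp [coprodRotate_first]⟩
    · exact ⟨2, g, by
        simp [pow_two, MulAut.mul_apply, coprodRotate_first, coprodRotate_second]⟩
  · simp [F]
  · rw [← ht, ← MulAut.conj_apply]
    suffices h : F.comp (coprodRotate G).toMonoidHom = C.toMonoidHom.comp F from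
      DFunLike.congr_fun h x
    ext g
    · simp [F, coprodRotate_first]
    · simp [F, coprodRotate_second]
    · have := DFunLike.congr_fun hC (Monoid.Coprod.inl g)
      simp only [MulAut.mul_apply, MulAut.one_apply] at this
      simp [F, coprodRotate_third, this]

end SemidirectProduct

theorem exists_not_mem_of_card_lt {G : Type*} [Nonempty G] (hG : Nat.card G = 0 ∨ 3 ≤ Nat.card G)
    (s : Finset G) (hs : s.card < 3) : ∃ x, x ∉ s := by
  by_contra! h
  let _ : Fintype G := ⟨s, h⟩
  have h1 : Nat.card G = s.card := Nat.card_eq_fintype_card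
  have h2 : 0 < Nat.card G := Nat.card_pos
  omega

/-- A finitely generated group with at least three elements has a finite generating set containing
two distinct non-identity elements. -/
theorem exists_finite_generators (G : Type*) [Group G] [Group.FG G]
    (hG : Nat.card G = 0 ∨ 3 ≤ Nat.card G) : ∃ (S : Set G) (p q : G), S.Finite ∧
      Subgroup.closure S = ⊤ ∧ p ∈ S ∧ q ∈ S ∧ p ≠ 1 ∧ q ≠ 1 ∧ p ≠ q := by
  classical
  obtain ⟨S, hS, hSf⟩ := Group.fg_iff.1 (inferInstance : Group.FG G)
  obtain ⟨p, hp⟩ := exists_not_mem_of_card_lt hG {1} (by simp)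
  obtain ⟨q, hq⟩ := exists_not_mem_of_card_lt hG {1, p} (Finset.card_le_two.trans_lt (by simp))
  simp only [Finset.mem_insert, Finset.mem_singleton, not_or] at hp hq
  refine ⟨S ∪ {p, q}, p, q, hSf.union (Set.toFinite _), ?_, by simp, by simp, hp, hq.1,
    Ne.symm hq.2⟩
  rw [Subgroup.closure_union, hS, top_sup_eq]

theorem closure_ofAdd_one_int : Subgroup.closure {Multiplicative.ofAdd (1 : ℤ)} = ⊤ := by
  rw [eq_top_iff]
  intro x _
  rw [Subgroup.mem_closure_singleton]
  exact ⟨x.toAdd, by rw [← ofAdd_zsmul, zsmul_one]; rfl⟩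

/-- Let `G` be any finitely generated group of order at least three (possibly
infinite).  Then the groups `G * G`, `G * ℤ`, `G * G * G` and `G * ℤ/2ℤ` are
all quasi-isometric to one another. -/
theorem coprods_pairwise_quasiIsometric (G : Type) [Group G] [Group.FG G]
    (hG : Nat.card G = 0 ∨ 3 ≤ Nat.card G) :
    QuasiIsometricGroups (Monoid.Coprod G G) (Monoid.Coprod G (Multiplicative ℤ)) ∧
    QuasiIsometricGroups (Monoid.Coprod G G) (Monoid.Coprod (Monoid.Coprod G G) G) ∧
    QuasiIsometricGroups (Monoid.Coprod G G) (Monoid.Coprod G (Multiplicative (ZMod 2))) ∧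
    QuasiIsometricGroups (Monoid.Coprod G (Multiplicative ℤ))
      (Monoid.Coprod (Monoid.Coprod G G) G) ∧
    QuasiIsometricGroups (Monoid.Coprod G (Multiplicative ℤ))
      (Monoid.Coprod G (Multiplicative (ZMod 2))) ∧
    QuasiIsometricGroups (Monoid.Coprod (Monoid.Coprod G G) G)
      (Monoid.Coprod G (Multiplicative (ZMod 2))) := by
  classical
  obtain ⟨S, p, q, hSf, hS, hpS, hqS, hp, hq, hpq⟩ := exists_finite_generators G hG
  have tree (c : G → ℕ) (m : ℕ) (hc : ∀ g ≠ 1, 0 < c g) (hm : 0 < m) (hM : ∀ g, c g ≤ 2) :=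
    coarselyEquivalent_slotAdj_treeAdj hpS hqS hp hq hpq hc hm hM
  have hct (k : ℕ) := closure_ofAdd_one_zmod k
  have fin₂ := Set.finite_singleton (Multiplicative.ofAdd (1 : ZMod 2))
  have fin₃ := Set.finite_singleton (Multiplicative.ofAdd (1 : ZMod 3))
  have finZ := Set.finite_singleton (Multiplicative.ofAdd (1 : ℤ))
  have f₂ := (hSf.image (Monoid.Coprod.inl (N := Multiplicative (ZMod 2)))).union
    (fin₂.image Monoid.Coprod.inr)
  have f₃ := (hSf.image (Monoid.Coprod.inl (N := Multiplicative (ZMod 3)))).union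
    (fin₃.image Monoid.Coprod.inr)
  have fZ := (hSf.image (Monoid.Coprod.inl (N := Multiplicative ℤ))).union
    (finZ.image Monoid.Coprod.inr)
  have fS := (hSf.image (Monoid.Coprod.inl (N := G))).union (hSf.image Monoid.Coprod.inr)
  have fSS := (fS.image (Monoid.Coprod.inl (N := G))).union (hSf.image Monoid.Coprod.inr)
  have g₂ := closure_coprod hS (hct 2)
  have g₃ := closure_coprod hS (hct 3)
  have gZ := closure_coprod hS closure_ofAdd_one_int
  have gS := closure_coprod hS hS
  have gSS := closure_coprod gS hS
  have e₂ := (coarselyEquivalent_finite_coprod hS (hct 2)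
    (Multiplicative.ofAdd : ZMod 2 ≃ Multiplicative (ZMod 2)) rfl).trans (tree (constMult 1) 2
      (by simp +contextual [constMult]) two_pos fun g => by unfold constMult; split_ifs <;> simp).symm
  have e₃ := (coarselyEquivalent_finite_coprod hS (hct 3)
    (Multiplicative.ofAdd : ZMod 3 ≃ Multiplicative (ZMod 3)) rfl).trans (tree (constMult 2) 3
      (by simp +contextual [constMult]) three_pos fun g => by
        unfold constMult; split_ifs <;> simp).symm
  have eZ := (coarselyEquivalent_int_coprod hS closure_ofAdd_one_int).trans (tree lineMult 2
    (by simp +contextual [lineMult]) two_pos fun g => by unfold lineMult; split_ifs <;> simp).symm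
  have eS := (coarselyEquivalent_coprod_self hSf hS f₂ g₂).trans e₂
  have eSS := (coarselyEquivalent_coprod_coprod_self hSf hS f₃ g₃).trans e₃
  exact ⟨(eS.trans eZ.symm).quasiIsometricGroups fS fZ gS gZ,
    (eS.trans eSS.symm).quasiIsometricGroups fS fSS gS gSS,
    (eS.trans e₂.symm).quasiIsometricGroups fS f₂ gS g₂,
    (eZ.trans eSS.symm).quasiIsometricGroups fZ fSS gZ gSS,
    (eZ.trans e₂.symm).quasiIsometricGroups fZ f₂ gZ g₂,
    (eSS.trans e₂.symm).quasiIsometricGroups fSS f₂ gSS g₂⟩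
end
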